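/- arXiv:1508.03816 — 2 statements merged into one kernel-verified Lean document; each statement's English description precedes it below -/
import Mathlib

section
/- Let g be a psd sextic form in ℝ[x₀,x₁,x₂] whose real projective zero set V_ℝ(g) is finite, and let S ⊂ V_ℝ(g) with |S| = 9. If the space I₃(S) of cubic forms vanishing at every point of S has dimension 2, then g is a sum of two squares of cubic forms; in particular g is reducible over ℂ. -/
open MvPolynomial

noncomputable section

/-- The real projective plane, as lines through the origin of `ℝ³`. -/
abbrev P2 := Projectivization ℝ (Fin 3 → ℝ)

/-- A polynomial is psd if it takes only nonnegative values on `ℝ³`. -/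
def Psd (g : MvPolynomial (Fin 3) ℝ) : Prop := ∀ u : Fin 3 → ℝ, 0 ≤ eval u g

/-- A polynomial is sos if it is a finite sum of squares. -/
def Sos (g : MvPolynomial (Fin 3) ℝ) : Prop :=
  ∃ (n : ℕ) (h : Fin n → MvPolynomial (Fin 3) ℝ), g = ∑ i, (h i) ^ 2

/-- A form vanishes at a point of `ℙ²(ℝ)` if it vanishes at a representative vector. -/
def VanishAt (g : MvPolynomial (Fin 3) ℝ) (P : P2) : Prop := eval P.rep g = 0

/-- A form is singular at a point of `ℙ²(ℝ)` if it and all its first partial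
derivatives vanish at a representative vector. -/
def SingAt (g : MvPolynomial (Fin 3) ℝ) (P : P2) : Prop :=
  eval P.rep g = 0 ∧ ∀ i, eval P.rep (pderiv i g) = 0

/-- `I_d(T)`: the space of degree-`d` forms vanishing at every point of `T`. -/
def Isub (d : ℕ) (T : Set P2) : Submodule ℝ (MvPolynomial (Fin 3) ℝ) :=
  (homogeneousSubmodule (Fin 3) ℝ d) ⊓
  { carrier := {f | ∀ P ∈ T, VanishAt f P}
    zero_mem' := by intro P _; simp [VanishAt]
    add_mem' := by
      intro a b ha hb P hP
      have h1 := ha P hP; have h2 := hb P hP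
      unfold VanishAt at *; simp [h1, h2]
    smul_mem' := by
      intro c f hf P hP
      have h1 := hf P hP
      unfold VanishAt at *; simp [smul_eq_C_mul, h1] }

/-- `I_d(2T)`: the space of degree-`d` forms singular at every point of `T`. -/
def Isub2 (d : ℕ) (T : Set P2) : Submodule ℝ (MvPolynomial (Fin 3) ℝ) :=
  (homogeneousSubmodule (Fin 3) ℝ d) ⊓
  { carrier := {f | ∀ P ∈ T, SingAt f P}
    zero_mem' := by intro P _; constructor <;> simp [SingAt]
    add_mem' := by
      intro a b ha hb P hP
      obtain ⟨h1, h2⟩ := ha P hP; obtain ⟨h3, h4⟩ := hb P hP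
      exact ⟨by simp [h1, h3], fun i => by simp [h2 i, h4 i]⟩
    smul_mem' := by
      intro c f hf P hP
      obtain ⟨h1, h2⟩ := hf P hP
      refine ⟨by simp [smul_eq_C_mul, h1], fun i => ?_⟩
      have := h2 i
      simp [smul_eq_C_mul, this] }

/-- `I₃(T)²`: the span of products of two cubics vanishing on `T`. -/
def IsqCubic (T : Set P2) : Submodule ℝ (MvPolynomial (Fin 3) ℝ) :=
  Submodule.span ℝ {h | ∃ f₁ ∈ Isub 3 T, ∃ f₂ ∈ Isub 3 T, h = f₁ * f₂}

/-- No 4 points of `T` on a line, no 7 on a conic. -/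
def GenPos (T : Set P2) : Prop :=
  (∀ l : MvPolynomial (Fin 3) ℝ, l ≠ 0 → l.IsHomogeneous 1 →
    {P ∈ T | VanishAt l P}.encard ≤ 3) ∧
  (∀ c : MvPolynomial (Fin 3) ℝ, c ≠ 0 → c.IsHomogeneous 2 →
    {P ∈ T | VanishAt c P}.encard ≤ 6)

/-- The real projective zero set of `g`. -/
def VR (g : MvPolynomial (Fin 3) ℝ) : Set P2 := {P | VanishAt g P}

open scoped Matrix

lemma hom_eval_smul {f : MvPolynomial (Fin 3) ℝ} {n : ℕ} (hf : f.IsHomogeneous n) (a : ℝ)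
    (x : Fin 3 → ℝ) : eval (a • x) f = a ^ n * eval x f := by
  rw [eval_eq, eval_eq, Finset.mul_sum]
  refine Finset.sum_congr rfl fun d hd => ?_
  have h := hf.degree_eq_sum_deg_support hd
  simp only [Pi.smul_apply, smul_eq_mul, mul_pow, Finset.prod_mul_distrib,
    Finset.prod_pow_eq_pow_sum]
  have h2 : ∑ i ∈ d.support, d i = n := by
    rw [h]
  rw [h2]; ring

/-- The grading homomorphism. -/
def gradHom : MvPolynomial (Fin 3) ℝ →ₐ[ℝ] Polynomial (MvPolynomial (Fin 3) ℝ) :=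
  aeval (fun i => Polynomial.C (X i) * Polynomial.X)

lemma gradHom_hom {f : MvPolynomial (Fin 3) ℝ} {n : ℕ} (hf : f.IsHomogeneous n) :
    gradHom f = Polynomial.C f * Polynomial.X ^ n := by
  conv_lhs => rw [f.as_sum]
  conv_rhs => rw [f.as_sum]
  rw [map_sum, map_sum, Finset.sum_mul]
  refine Finset.sum_congr rfl fun d hd => ?_
  have h := hf.degree_eq_sum_deg_support hd
  have h2 : ∑ i ∈ d.support, d i = n := by
    rw [h]
  rw [gradHom, aeval_monomial, monomial_eq]
  simp only [Finsupp.prod, mul_pow, Finset.prod_mul_distrib, Finset.prod_pow_eq_pow_sum, h2,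
    map_mul, map_prod, map_pow]
  rw [mul_assoc]; rfl

lemma gradHom_coeff (f : MvPolynomial (Fin 3) ℝ) (k : ℕ) :
    (gradHom f).coeff k = homogeneousComponent k f := by
  have h : gradHom f = ∑ i ∈ Finset.range (f.totalDegree + 1),
      Polynomial.C (homogeneousComponent i f) * Polynomial.X ^ i := by
    conv_lhs => rw [← sum_homogeneousComponent f]
    rw [map_sum]
    exact Finset.sum_congr rfl fun i _ => gradHom_hom (homogeneousComponent_isHomogeneous i f)
  rw [h, Polynomial.finsetSum_coeff]
  simp only [Polynomial.coeff_C_mul_X_pow]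
  rw [Finset.sum_ite_eq]
  split_ifs with hk
  · rfl
  · rw [homogeneousComponent_eq_zero]
    simpa using hk

lemma gradHom_eval (f : MvPolynomial (Fin 3) ℝ) : (gradHom f).eval 1 = f := by
  have : (Polynomial.evalRingHom (1 : MvPolynomial (Fin 3) ℝ)).comp (gradHom : _ →+* _)
      = RingHom.id _ := by
    apply MvPolynomial.ringHom_ext
    · intro r
      simp [gradHom, Polynomial.algebraMap_apply]
    · intro i
      simp [gradHom]
  exact congrArg (fun φ => φ f) this

lemma hom_factor {p q : MvPolynomial (Fin 3) ℝ} {n : ℕ} (h : (p * q).IsHomogeneous n)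
    (h0 : p * q ≠ 0) : ∃ i j, i + j = n ∧ p.IsHomogeneous i ∧ q.IsHomogeneous j := by
  have hp0 : gradHom p ≠ 0 := by
    intro h; apply h0; rw [← gradHom_eval p, h]; simp
  have hq0 : gradHom q ≠ 0 := by
    intro h; apply h0; rw [← gradHom_eval q, h]; simp
  have e : gradHom p * gradHom q = Polynomial.C (p * q) * Polynomial.X ^ n := by
    rw [← map_mul]; exact gradHom_hom h
  have hd : (gradHom p).natDegree + (gradHom q).natDegree = n := by
    rw [← Polynomial.natDegree_mul hp0 hq0, e, Polynomial.natDegree_C_mul_X_pow _ _ h0]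
  have ht : (gradHom p).natTrailingDegree + (gradHom q).natTrailingDegree = n := by
    rw [← Polynomial.natTrailingDegree_mul hp0 hq0, e, Polynomial.C_mul_X_pow_eq_monomial,
      Polynomial.natTrailingDegree_monomial h0]
  have key : ∀ r : MvPolynomial (Fin 3) ℝ,
      (gradHom r).natDegree = (gradHom r).natTrailingDegree →
      r.IsHomogeneous (gradHom r).natDegree := by
    intro r hr
    generalize hk : (gradHom r).natDegree = k at hr ⊢
    rw [← sum_homogeneousComponent r]
    apply IsHomogeneous.sum
    intro i _
    by_cases hi : i = k
    · rw [← hi]; exact homogeneousComponent_isHomogeneous _ _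
    · have : homogeneousComponent i r = 0 := by
        rw [← gradHom_coeff]
        rcases lt_or_gt_of_ne hi with h1 | h1
        · exact Polynomial.coeff_eq_zero_of_lt_natTrailingDegree (hr ▸ h1)
        · exact Polynomial.coeff_eq_zero_of_natDegree_lt (hk ▸ h1)
      rw [this]; exact isHomogeneous_zero _ _ _
  have a1 := Polynomial.natTrailingDegree_le_natDegree (gradHom p)
  have a2 := Polynomial.natTrailingDegree_le_natDegree (gradHom q)
  exact ⟨_, _, hd, key p (by omega), key q (by omega)⟩

lemma hom_zero_const {f : MvPolynomial (Fin 3) ℝ} (hf : f.IsHomogeneous 0) : ∃ a, f = C a := by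
  have := (totalDegree_zero_iff_isHomogeneous (σ := Fin 3)).mpr hf
  exact ⟨_, totalDegree_eq_zero_iff_eq_C.mp this⟩

/-- linear form with given coefficient vector -/
def lin (n : Fin 3 → ℝ) : MvPolynomial (Fin 3) ℝ := ∑ i, C (n i) * X i

lemma lin_hom (n : Fin 3 → ℝ) : (lin n).IsHomogeneous 1 := by
  apply IsHomogeneous.sum
  intro i _
  exact isHomogeneous_C_mul_X _ _

lemma eval_lin (n x : Fin 3 → ℝ) : eval x (lin n) = n ⬝ᵥ x := by
  simp [lin, dotProduct]

lemma pderiv_lin (n : Fin 3 → ℝ) (i : Fin 3) : pderiv i (lin n) = C (n i) := by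
  simp [lin, Fin.sum_univ_three, Derivation.leibniz, pderiv_X, Pi.single_apply]
  fin_cases i <;> simp

lemma hom_one_eq_lin {m : MvPolynomial (Fin 3) ℝ} (hm : m.IsHomogeneous 1) : ∃ n, m = lin n := by
  have h : ∀ i, ∃ a, pderiv i m = C a := fun i => hom_zero_const hm.pderiv
  choose a ha using h
  refine ⟨a, ?_⟩
  have := hm.sum_X_mul_pderiv
  simp only [ha, one_smul] at this
  rw [← this, lin]
  exact Finset.sum_congr rfl fun i _ => mul_comm _ _

lemma lin_zero : lin 0 = 0 := by simp [lin]

lemma hom_two_eval {c : MvPolynomial (Fin 3) ℝ} (hc : c.IsHomogeneous 2) :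
    ∃ M : Fin 3 → Fin 3 → ℝ, ∀ x, eval x c = ∑ i, ∑ j, M i j * x i * x j := by
  have h : ∀ i, ∃ n, pderiv i c = lin n := fun i => hom_one_eq_lin hc.pderiv
  choose n hn using h
  refine ⟨fun i j => n i j / 2, fun x => ?_⟩
  have := congrArg (eval x) hc.sum_X_mul_pderiv
  simp only [hn, map_sum, map_mul, eval_X, eval_lin, map_nsmul] at this
  simp [dotProduct, Fin.sum_univ_three] at this ⊢
  linarith

lemma finrank_hom (d : ℕ) :
    Module.finrank ℝ (homogeneousSubmodule (Fin 3) ℝ d) = (d + 2).choose d := by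
  have h1 : homogeneousSubmodule (Fin 3) ℝ d = restrictSupport ℝ {e | e.degree = d} :=
    homogeneousSubmodule_eq_finsupp_supported _ _ d
  rw [h1, Module.finrank_eq_nat_card_basis (basisRestrictSupport ℝ {e | e.degree = d})]
  have h2 : {e : Fin 3 →₀ ℕ | e.degree = d} =
      ((Finset.univ : Finset (Fin 3)).finsuppAntidiag d : Set (Fin 3 →₀ ℕ)) := by
    ext e
    simp [Finsupp.degree_eq_sum]
  rw [h2]
  simp only [Finset.mem_coe, Nat.card_eq_fintype_card, Fintype.card_coe, SetLike.coe_sort_coe]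
  rw [Finset.card_finsuppAntidiag_nat_eq_choose]
  simp only [Finset.card_univ, Fintype.card_fin]
  congr 1; omega

instance hom_finite (d : ℕ) : Module.Finite ℝ (homogeneousSubmodule (Fin 3) ℝ d) :=
  Module.Finite.iff_fg.mpr (homogeneousSubmodule_fg (Fin 3) ℝ d)

lemma univ_zero {f : Polynomial ℝ} {k : ℕ} (hd : f.natDegree ≤ 2 * k)
    (hnn : ∀ t, 0 ≤ f.eval t) (T : Finset ℝ) (hT : ∀ t ∈ T, f.eval t = 0) (hc : k < T.card) :
    f = 0 := by
  by_contra hf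
  have hm : ∀ t ∈ T, 2 ≤ f.roots.count t := by
    intro t ht
    rw [Polynomial.count_roots]
    refine (Polynomial.one_lt_rootMultiplicity_iff_isRoot hf).mpr ⟨hT t ht, ?_⟩
    have hmin : IsLocalMin (fun s => f.eval s) t :=
      Filter.Eventually.of_forall fun s => by simpa [hT t ht] using hnn s
    have := hmin.hasDerivAt_eq_zero (f.hasDerivAt t)
    exact this
  have h1 : ∑ t ∈ T, 2 ≤ ∑ t ∈ T, f.roots.count t := Finset.sum_le_sum hm
  have h2 : ∑ t ∈ T, f.roots.count t ≤ Multiset.card f.roots :=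
    calc _ ≤ ∑ t ∈ T ∪ f.roots.toFinset, f.roots.count t :=
          Finset.sum_le_sum_of_subset Finset.subset_union_left
      _ = _ := Multiset.sum_count_eq_card (by intro a ha; simp [Multiset.mem_toFinset, ha])
  have h3 := Polynomial.card_roots' f
  rw [Finset.sum_const, smul_eq_mul] at h1
  omega

lemma poly_curve {g : MvPolynomial (Fin 3) ℝ} {e : ℕ} (hg : g.IsHomogeneous 6) (hp : Psd g)
    (φ : Fin 3 → Polynomial ℝ) (hφ : ∀ i, (φ i).natDegree ≤ e) (T : Finset ℝ)
    (hT : ∀ t ∈ T, eval (fun i => (φ i).eval t) g = 0) (hc : 3 * e < T.card) (t : ℝ) :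
    eval (fun i => (φ i).eval t) g = 0 := by
  have hev : ∀ t, (aeval φ g).eval t = eval (fun i => (φ i).eval t) g := by
    intro t
    rw [← Polynomial.coe_evalRingHom, aeval_def, hom_eval₂]
    simp only [eval, coe_eval₂Hom]
    congr 1
    ext r; simp
  have hz : aeval φ g = 0 := by
    apply univ_zero (k := 3 * e) _ (fun t => by rw [hev]; exact hp _) T (fun t ht => by
      rw [hev]; exact hT t ht) hc
    have := MvPolynomial.aeval_natDegree_le g hg.totalDegree_le φ hφ
    omega
  rw [← hev, hz]; simp

lemma vanish_mk {g : MvPolynomial (Fin 3) ℝ} {n : ℕ} (hg : g.IsHomogeneous n)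
    (v : Fin 3 → ℝ) (hv : v ≠ 0) (h : eval v g = 0) :
    VanishAt g (Projectivization.mk ℝ v hv) := by
  obtain ⟨a, ha⟩ := Projectivization.exists_smul_eq_mk_rep ℝ v hv
  unfold VanishAt
  rw [← ha]
  have := hom_eval_smul hg (a : ℝ) v
  rw [h, mul_zero] at this
  exact this

/-- coordinates: if the triple product is nonzero, combos are injective -/
lemma triple_indep {a b c : Fin 3 → ℝ} (h : a ⬝ᵥ (b ⨯₃ c) ≠ 0) {x y z : ℝ}
    (hz : x • a + y • b + z • c = 0) : x = 0 ∧ y = 0 ∧ z = 0 := by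
  have h0 := congrFun hz 0
  have h1 := congrFun hz 1
  have h2 := congrFun hz 2
  simp [cross_apply, dotProduct, Fin.sum_univ_three] at h h0 h1 h2
  refine ⟨?_, ?_, ?_⟩
  · apply (mul_eq_zero.mp (_ : x * _ = 0)).resolve_right h
    linear_combination (b 1 * c 2 - b 2 * c 1) * h0 + (b 2 * c 0 - b 0 * c 2) * h1 +
      (b 0 * c 1 - b 1 * c 0) * h2
  · apply (mul_eq_zero.mp (_ : y * _ = 0)).resolve_right h
    linear_combination (c 1 * a 2 - c 2 * a 1) * h0 + (c 2 * a 0 - c 0 * a 2) * h1 +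
      (c 0 * a 1 - c 1 * a 0) * h2
  · apply (mul_eq_zero.mp (_ : z * _ = 0)).resolve_right h
    linear_combination (a 1 * b 2 - a 2 * b 1) * h0 + (a 2 * b 0 - a 0 * b 2) * h1 +
      (a 0 * b 1 - a 1 * b 0) * h2

lemma triple_span {a b c : Fin 3 → ℝ} (h : a ⬝ᵥ (b ⨯₃ c) ≠ 0) (v : Fin 3 → ℝ) :
    ∃ x y z : ℝ, v = x • a + y • b + z • c := by
  refine ⟨(v ⬝ᵥ (b ⨯₃ c)) / (a ⬝ᵥ (b ⨯₃ c)), (v ⬝ᵥ (c ⨯₃ a)) / (a ⬝ᵥ (b ⨯₃ c)),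
    (v ⬝ᵥ (a ⨯₃ b)) / (a ⬝ᵥ (b ⨯₃ c)), ?_⟩
  have h' : (a ⬝ᵥ (b ⨯₃ c)) • v = (v ⬝ᵥ (b ⨯₃ c)) • a + (v ⬝ᵥ (c ⨯₃ a)) • b
      + (v ⬝ᵥ (a ⨯₃ b)) • c := by
    ext i
    fin_cases i <;> simp [cross_apply, dotProduct, Fin.sum_univ_three] <;> ring
  have : v = (a ⬝ᵥ (b ⨯₃ c))⁻¹ • ((a ⬝ᵥ (b ⨯₃ c)) • v) := by
    rw [smul_smul, inv_mul_cancel₀ h, one_smul]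
  rw [h'] at this
  conv_lhs => rw [this]
  simp only [smul_add, smul_smul, div_eq_inv_mul]

lemma exists_triple {a : Fin 3 → ℝ} (h : a ≠ 0) : ∃ b c : Fin 3 → ℝ, a ⬝ᵥ (b ⨯₃ c) ≠ 0 := by
  by_contra! hc
  apply h
  have h0 := hc ![0, 1, 0] ![0, 0, 1]
  have h1 := hc ![0, 0, 1] ![1, 0, 0]
  have h2 := hc ![1, 0, 0] ![0, 1, 0]
  simp [cross_apply, dotProduct, Fin.sum_univ_three] at h0 h1 h2
  ext i; fin_cases i <;> simp [h0, h1, h2]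

lemma exists_triple2 {a b : Fin 3 → ℝ} (h : a ⨯₃ b ≠ 0) :
    ∃ c : Fin 3 → ℝ, c ⬝ᵥ (a ⨯₃ b) ≠ 0 :=
  ⟨a ⨯₃ b, by simpa using h⟩

lemma curve_infinite {g : MvPolynomial (Fin 3) ℝ} {n : ℕ} (hg : g.IsHomogeneous n)
    {e e' w : Fin 3 → ℝ} (h : e ⬝ᵥ (e' ⨯₃ w) ≠ 0) (τ : ℝ → ℝ)
    (hz : ∀ s : ℝ, eval (e + s • e' + τ s • w) g = 0) : ¬ (VR g).Finite := by
  intro hfin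
  have hne : ∀ s : ℝ, e + s • e' + τ s • w ≠ 0 := by
    intro s hs
    have := (triple_indep h (x := 1) (y := s) (z := τ s) (by rw [one_smul]; exact hs)).1
    exact one_ne_zero this
  have hinj : Function.Injective
      (fun s : ℝ => Projectivization.mk ℝ (e + s • e' + τ s • w) (hne s)) := by
    intro s s' hss
    obtain ⟨a, ha⟩ := (Projectivization.mk_eq_mk_iff' ℝ _ _ _ _).mp hss
    have : (a - 1) • e + (a * s' - s) • e' + (a * τ s' - τ s) • w = 0 := by
      have h2 := sub_eq_zero.mpr ha
      rw [← h2]; module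
    obtain ⟨h1, h2, -⟩ := triple_indep h this
    have ha1 : a = 1 := by linarith
    subst ha1; linarith
  exact Set.infinite_of_injective_forall_mem hinj (fun s => vanish_mk hg _ (hne s) (hz s)) hfin

lemma hasDeriv_line (f : MvPolynomial (Fin 3) ℝ) (P v : Fin 3 → ℝ) :
    HasDerivAt (fun t : ℝ => eval (P + t • v) f) (∑ i, v i * eval P (pderiv i f)) 0 := by
  induction f using MvPolynomial.induction_on with
  | C a => simpa using hasDerivAt_const (0 : ℝ) a
  | add p q hp hq =>
    have := hp.add hq
    have e : (fun t : ℝ => eval (P + t • v) (p + q)) =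
        (fun t : ℝ => eval (P + t • v) p) + (fun t : ℝ => eval (P + t • v) q) := by
      funext t; simp
    rw [e]
    refine this.congr_deriv ?_
    simp [mul_add, Finset.sum_add_distrib]
  | mul_X p i hp =>
    have h1 : HasDerivAt (fun t : ℝ => P i + t * v i) (v i) 0 := by
      simpa using ((hasDerivAt_id (0 : ℝ)).mul_const (v i)).const_add (P i)
    have := hp.mul h1
    have e : (fun t : ℝ => eval (P + t • v) (p * X i)) =
        (fun t : ℝ => eval (P + t • v) p) * (fun t : ℝ => P i + t * v i) := by
      funext t; simp
    rw [e]
    refine this.congr_deriv ?_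
    simp only [Derivation.leibniz, pderiv_X, smul_eq_mul, map_add, map_mul, eval_X, zero_smul,
      add_zero, zero_mul, mul_add, Finset.sum_add_distrib, Finset.sum_mul]
    rw [add_comm]
    congr 1
    · fin_cases i <;> simp [Fin.sum_univ_three, Pi.single_apply] <;> ring
    · exact Finset.sum_congr rfl fun j _ => by ring

lemma grad_zero {g : MvPolynomial (Fin 3) ℝ} (hp : Psd g) {P : Fin 3 → ℝ} (hP : eval P g = 0)
    (i : Fin 3) : eval P (pderiv i g) = 0 := by
  have h := hasDeriv_line g P (Pi.single i 1)
  have hmin : IsLocalMin (fun t : ℝ => eval (P + t • Pi.single i 1) g) 0 :=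
      Filter.Eventually.of_forall fun s => by simpa [hP] using hp _
  have := hmin.hasDerivAt_eq_zero h
  simpa [Pi.single_apply] using this

lemma dot_self_pos' {n : Fin 3 → ℝ} (hn : n ≠ 0) : 0 < n ⬝ᵥ n := by
  have h1 : n ⬝ᵥ n ≠ 0 := by simpa using hn
  have h2 : 0 ≤ n ⬝ᵥ n := by
    simp [dotProduct, Fin.sum_univ_three]; nlinarith [sq_nonneg (n 0), sq_nonneg (n 1), sq_nonneg (n 2)]
  exact lt_of_le_of_ne h2 h1.symm

lemma cross_rep_ne {A B : P2} (h : A ≠ B) : A.rep ⨯₃ B.rep ≠ 0 := by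
  rw [crossProduct_ne_zero_iff_linearIndependent]
  exact Projectivization.linearIndependent_pair_iff_ne.mpr h

lemma eq_of_rep_smul {A B : P2} {a b : ℝ} {v : Fin 3 → ℝ} (hA : A.rep = a • v)
    (hB : B.rep = b • v) : A = B := by
  by_contra h
  apply cross_rep_ne h
  rw [hA, hB]; simp

/-- at most three zeros of g on a line -/
lemma line_le {g : MvPolynomial (Fin 3) ℝ} (hg : g.IsHomogeneous 6) (hp : Psd g)
    (hfin : (VR g).Finite) {n : Fin 3 → ℝ} (hn : n ≠ 0) (T : Finset P2)
    (hT : ∀ P ∈ T, VanishAt g P) (hTn : ∀ P ∈ T, n ⬝ᵥ P.rep = 0) : T.card ≤ 3 := by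
  by_contra! hc
  have hnn : 0 < n ⬝ᵥ n := dot_self_pos' hn
  have hex : ∃ w, n ⬝ᵥ w = 0 ∧ eval w g ≠ 0 := by
    by_contra! hall
    obtain ⟨x, y, hxy⟩ := exists_triple hn
    have hx : n ⨯₃ x ≠ 0 := by
      intro h; apply hxy
      rw [triple_product_permutation, triple_product_permutation, h]; simp
    have : (n ⨯₃ x) ⬝ᵥ ((n ⨯₃ (n ⨯₃ x)) ⨯₃ n) ≠ 0 := by
      have h1 : (n ⨯₃ x) ⬝ᵥ ((n ⨯₃ (n ⨯₃ x)) ⨯₃ n) = (n ⬝ᵥ n) * ((n ⨯₃ x) ⬝ᵥ (n ⨯₃ x)) := by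
        simp [cross_apply, dotProduct, Fin.sum_univ_three]; ring
      rw [h1]
      exact mul_ne_zero hnn.ne' (by simpa using hx)
    refine curve_infinite hg this (fun _ => 0) (fun s => ?_) hfin
    apply hall
    simp [dotProduct_add]
  obtain ⟨w, hnw, hw⟩ := hex
  have hw0 : w ≠ 0 := by
    rintro rfl
    apply hw
    have := hom_eval_smul hg 0 0
    simpa using this
  have hww : 0 < w ⬝ᵥ w := dot_self_pos' hw0
  have htr : (n ⨯₃ w) ⬝ᵥ (w ⨯₃ n) ≠ 0 := by
    have : (n ⨯₃ w) ⬝ᵥ (w ⨯₃ n) = (n ⬝ᵥ w)^2 - (n ⬝ᵥ n) * (w ⬝ᵥ w) := by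
      simp [cross_apply, dotProduct, Fin.sum_univ_three]; ring
    rw [this, hnw]
    have := mul_pos hnn hww
    intro h; nlinarith
  have key : ∀ P ∈ T, ∃ t a : ℝ, a ≠ 0 ∧ P.rep = a • (n ⨯₃ w + t • w) := by
    intro P hP
    obtain ⟨x, y, z, hxyz⟩ := triple_span htr P.rep
    have hz : z = 0 := by
      have h1 := hTn P hP
      rw [hxyz] at h1
      simp [dotProduct_add, hnw] at h1
      exact h1.resolve_right hn
    subst hz
    have hx : x ≠ 0 := by
      rintro rfl
      have h1 := hT P hP
      unfold VanishAt at h1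
      have h2 : P.rep = y • w := by rw [hxyz]; module
      rw [h2, hom_eval_smul hg] at h1
      have hy : y ≠ 0 := by
        rintro rfl
        exact P.rep_nonzero (by rw [h2]; simp)
      exact (mul_ne_zero (pow_ne_zero _ hy) hw) h1
    refine ⟨y / x, x, hx, ?_⟩
    rw [hxyz, smul_add, smul_smul, mul_div_cancel₀ _ hx]; simp
  choose! t a ha hPt using key
  have hinj : Set.InjOn t T := by
    intro P hP Q hQ h
    refine eq_of_rep_smul (hPt P hP) (by rw [h]; exact hPt Q hQ)
  let φ : Fin 3 → Polynomial ℝ := fun i => Polynomial.C ((n ⨯₃ w) i) + Polynomial.C (w i) * Polynomial.X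
  have hφ : ∀ s : ℝ, (fun i => (φ i).eval s) = n ⨯₃ w + s • w := by
    intro s; ext i; simp [φ, mul_comm (w i)]
  have hall := poly_curve (e := 1) hg hp φ (fun i => by simp only [φ]; compute_degree) (T.image t)
    (by
      intro s hs
      obtain ⟨P, hP, rfl⟩ := Finset.mem_image.mp hs
      rw [hφ]
      have h1 := hT P hP
      unfold VanishAt at h1
      rw [hPt P hP, hom_eval_smul hg] at h1
      exact (mul_eq_zero.mp h1).resolve_left (pow_ne_zero _ (ha P hP)))
    (by rw [Finset.card_image_of_injOn hinj]; omega)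
  refine curve_infinite hg htr (fun _ => 0) (fun s => ?_) hfin
  have := hall s
  rw [hφ] at this
  simpa using this

/-- a real cubic form has infinitely many zeros -/
lemma cubic_infinite {f : MvPolynomial (Fin 3) ℝ} (hf : f.IsHomogeneous 3) (h0 : f ≠ 0) :
    ¬ (VR f).Finite := by
  have : ∃ w, eval w f ≠ 0 := by
    by_contra! h
    exact h0 (MvPolynomial.funext fun x => by simpa using h x)
  obtain ⟨w, hw⟩ := this
  have hw0 : w ≠ 0 := by
    rintro rfl
    apply hw
    have := hom_eval_smul hf 0 0
    simpa using this
  obtain ⟨e, e', he⟩ := exists_triple hw0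
  rw [triple_product_permutation] at he
  have key : ∀ s : ℝ, ∃ t : ℝ, eval (e + s • e' + t • w) f = 0 := by
    intro s
    generalize e + s • e' = u
    -- continuity and sign change
    have hcont : Continuous fun x : Fin 3 → ℝ => eval x f := MvPolynomial.continuous_eval f
    have hc1 : Continuous fun r : ℝ => eval (r • u + w) f := by fun_prop
    have hc2 : Continuous fun r : ℝ => eval (r • u - w) f := by fun_prop
    have hneg : eval (-w) f = - eval w f := by
      have := hom_eval_smul hf (-1) w
      simpa using (this.trans (by ring : _ = - eval w f))
    have e1 : ∀ᶠ r in nhds (0 : ℝ), 0 < eval w f * eval (r • u + w) f := by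
      have : Continuous fun r : ℝ => eval w f * eval (r • u + w) f := by fun_prop
      apply this.continuousAt.eventually (lt_mem_nhds _)
      simp only [zero_smul, zero_add]
      exact mul_self_pos.mpr hw
    have e2 : ∀ᶠ r in nhds (0 : ℝ), eval w f * eval (r • u - w) f < 0 := by
      have : Continuous fun r : ℝ => eval w f * eval (r • u - w) f := by fun_prop
      apply this.continuousAt.eventually (gt_mem_nhds _)
      simp only [zero_smul, zero_sub, hneg]
      have := mul_self_pos.mpr hw
      linarith
    have e3 : ∀ᶠ r in nhdsWithin (0 : ℝ) (Set.Ioi 0), 0 < r := self_mem_nhdsWithin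
    obtain ⟨r, ⟨hr1, hr2⟩, hr3⟩ :=
      (((e1.and e2).filter_mono nhdsWithin_le_nhds).and e3).exists
    have c3 : Continuous fun t : ℝ => eval w f * eval (u + t • w) f := by fun_prop
    have a1 : 0 < eval w f * eval (u + r⁻¹ • w) f := by
      have : r • u + w = r • (u + r⁻¹ • w) := by
        rw [smul_add, smul_smul, mul_inv_cancel₀ hr3.ne', one_smul]
      rw [this, hom_eval_smul hf] at hr1
      have h3 : 0 < r ^ 3 := by positivity
      by_contra! hcon
      nlinarith
    have a2 : eval w f * eval (u + (-r⁻¹) • w) f < 0 := by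
      have : r • u - w = r • (u + (-r⁻¹) • w) := by
        rw [smul_add, smul_smul, mul_neg, mul_inv_cancel₀ hr3.ne', neg_one_smul]; rfl
      rw [this, hom_eval_smul hf] at hr2
      have h3 : 0 < r ^ 3 := by positivity
      by_contra! hcon
      nlinarith
    obtain ⟨t, ht⟩ := mem_range_of_exists_le_of_exists_ge c3 ⟨_, a2.le⟩ ⟨_, a1.le⟩
    exact ⟨t, (mul_eq_zero.mp ht).resolve_left hw⟩
  choose τ hτ using key
  exact curve_infinite hf he τ hτ

/-- no four points of `S` on a line -/
def NoFour (S : Set P2) : Prop := ∀ n : Fin 3 → ℝ, n ≠ 0 → ∀ T : Finset P2, (T : Set P2) ⊆ S →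
  (∀ P ∈ T, n ⬝ᵥ P.rep = 0) → T.card ≤ 3

lemma NoFour.tri {S : Set P2} (hS : NoFour S) {P A B C : P2} (hP : P ∈ S) (hA : A ∈ S)
    (hB : B ∈ S) (hC : C ∈ S) (hPA : P ≠ A) (hPB : P ≠ B) (hPC : P ≠ C) (hAB : A ≠ B)
    (hAC : A ≠ C) (hBC : B ≠ C) (h1 : P.rep ⬝ᵥ (A.rep ⨯₃ B.rep) = 0)
    (h2 : P.rep ⬝ᵥ (A.rep ⨯₃ C.rep) = 0) : False := by
  classical
  have h := hS (P.rep ⨯₃ A.rep) (cross_rep_ne hPA) {P, A, B, C}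
    (by
      intro x hx
      simp at hx
      rcases hx with rfl | rfl | rfl | rfl <;> assumption)
    (by
      intro x hx
      simp at hx
      rcases hx with rfl | rfl | rfl | rfl
      · rw [dotProduct_comm]; simp
      · rw [dotProduct_comm]; simp
      · rw [dotProduct_comm, triple_product_permutation]; exact h1
      · rw [dotProduct_comm, triple_product_permutation]; exact h2)
  have hc : ({P, A, B, C} : Finset P2).card = 4 := by
    rw [Finset.card_insert_of_notMem, Finset.card_insert_of_notMem, Finset.card_pair hBC]
    · simp [hAB, hAC]
    · simp [hPA, hPB, hPC]
  omega

lemma trip_swap (P A B : Fin 3 → ℝ) (h : P ⬝ᵥ (A ⨯₃ B) = 0) : P ⬝ᵥ (B ⨯₃ A) = 0 := by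
  rw [← cross_anticomm, dotProduct_neg, h, neg_zero]

lemma four_conic {S : Set P2} (hS : NoFour S) {P : P2} (hP : P ∈ S) (U : Finset P2)
    (hU : (U : Set P2) ⊆ S) (hPU : P ∉ U) (hc : U.card = 4) :
    ∃ h : MvPolynomial (Fin 3) ℝ, h.IsHomogeneous 2 ∧ (∀ Q ∈ U, eval Q.rep h = 0) ∧
      eval P.rep h ≠ 0 := by
  classical
  obtain ⟨A, V, hAV, rfl, hV⟩ := Finset.card_eq_succ.mp hc
  obtain ⟨B, C, D, hBC, hBD, hCD, rfl⟩ := Finset.card_eq_three.mp hV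
  have hA : A ∈ S := hU (by simp)
  have hB : B ∈ S := hU (by simp)
  have hC : C ∈ S := hU (by simp)
  have hD : D ∈ S := hU (by simp)
  simp only [Finset.mem_insert, Finset.mem_singleton, not_or] at hPU hAV
  obtain ⟨hPA, hPB, hPC, hPD⟩ := hPU
  obtain ⟨hAB, hAC, hAD⟩ := hAV
  have main : ∀ A B C D : P2, P.rep ⬝ᵥ (A.rep ⨯₃ B.rep) ≠ 0 → P.rep ⬝ᵥ (C.rep ⨯₃ D.rep) ≠ 0 →
      ∃ h : MvPolynomial (Fin 3) ℝ, h.IsHomogeneous 2 ∧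
        (eval A.rep h = 0 ∧ eval B.rep h = 0 ∧ eval C.rep h = 0 ∧ eval D.rep h = 0) ∧
      eval P.rep h ≠ 0 := by
    intro A B C D h1 h2
    refine ⟨lin (A.rep ⨯₃ B.rep) * lin (C.rep ⨯₃ D.rep), (lin_hom _).mul (lin_hom _), ?_, ?_⟩
    · simp only [map_mul, eval_lin]
      refine ⟨?_, ?_, ?_, ?_⟩
      · rw [dotProduct_comm _ A.rep]; simp
      · rw [dotProduct_comm _ B.rep]; simp
      · rw [dotProduct_comm _ C.rep, dotProduct_comm _ C.rep]; simp
      · rw [dotProduct_comm _ D.rep, dotProduct_comm _ D.rep]; simp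
    · simp only [map_mul, eval_lin]
      rw [dotProduct_comm _ P.rep, dotProduct_comm _ P.rep]
      exact mul_ne_zero h1 h2
  by_cases h1 : P.rep ⬝ᵥ (A.rep ⨯₃ B.rep) ≠ 0 ∧ P.rep ⬝ᵥ (C.rep ⨯₃ D.rep) ≠ 0
  · obtain ⟨h, hh, ⟨a, b, c, d⟩, e⟩ := main A B C D h1.1 h1.2
    exact ⟨h, hh, by simp [a, b, c, d], e⟩
  by_cases h2 : P.rep ⬝ᵥ (A.rep ⨯₃ C.rep) ≠ 0 ∧ P.rep ⬝ᵥ (B.rep ⨯₃ D.rep) ≠ 0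
  · obtain ⟨h, hh, ⟨a, b, c, d⟩, e⟩ := main A C B D h2.1 h2.2
    exact ⟨h, hh, by simp [a, b, c, d], e⟩
  exfalso
  rw [not_and_or, not_not, not_not] at h1 h2
  rcases h1 with h1 | h1 <;> rcases h2 with h2 | h2
  · exact hS.tri hP hA hB hC hPA hPB hPC hAB hAC hBC h1 h2
  · exact hS.tri hP hB hA hD hPB hPA hPD (Ne.symm hAB) hBD hAD (trip_swap _ _ _ h1) h2
  · exact hS.tri hP hC hD hA hPC hPD hPA hCD (Ne.symm hAC) (Ne.symm hAD) h1 (trip_swap _ _ _ h2)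
  · exact hS.tri hP hD hC hB hPD hPC hPB (Ne.symm hCD) (Ne.symm hBD) (Ne.symm hBC)
      (trip_swap _ _ _ h1) (trip_swap _ _ _ h2)

/-- evaluation of forms at vectors -/
def evL (d : ℕ) {ι : Type} (v : ι → Fin 3 → ℝ) :
    homogeneousSubmodule (Fin 3) ℝ d →ₗ[ℝ] (ι → ℝ) :=
  LinearMap.pi fun i => (aeval (R := ℝ) (v i)).toLinearMap ∘ₗ (homogeneousSubmodule (Fin 3) ℝ d).subtype

lemma evL_apply (d : ℕ) {ι : Type} (v : ι → Fin 3 → ℝ) (f : homogeneousSubmodule (Fin 3) ℝ d) (i : ι) :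
    evL d v f i = eval (v i) f.1 := by
  simp [evL, aeval_eq_eval]

lemma evL_ker (d : ℕ) {ι : Type} [Fintype ι] (v : ι → Fin 3 → ℝ)
    (h : ∀ i, ∃ f : MvPolynomial (Fin 3) ℝ, f.IsHomogeneous d ∧ (∀ j, j ≠ i → eval (v j) f = 0) ∧
      eval (v i) f ≠ 0) :
    Module.finrank ℝ (LinearMap.ker (evL d v)) + Fintype.card ι = (d + 2).choose d := by
  classical
  choose f hf h0 h1 using h
  have hs : LinearMap.range (evL d v) = ⊤ := by
    rw [LinearMap.range_eq_top]
    intro y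
    refine ⟨∑ i, (y i / eval (v i) (f i)) • (⟨f i, hf i⟩ : homogeneousSubmodule (Fin 3) ℝ d), ?_⟩
    ext j
    rw [map_sum, Finset.sum_apply, Finset.sum_eq_single j]
    · rw [map_smul, Pi.smul_apply, evL_apply]
      simp [h1 j]
    · intro i _ hij
      rw [map_smul, Pi.smul_apply, evL_apply]
      simp [h0 i j (Ne.symm hij)]
    · simp
  have := LinearMap.finrank_range_add_finrank_ker (evL d v)
  rw [hs, finrank_top, finrank_hom, Module.finrank_pi] at this
  omega

lemma one_dim_dep {V M : Type*} [AddCommGroup V] [Module ℝ V] [Module.Finite ℝ V]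
    [AddCommGroup M] [Module ℝ M] (f : V →ₗ[ℝ] M) (h : Module.finrank ℝ V = 1) (a b : V) :
    ¬ LinearIndependent ℝ ![f a, f b] := by
  intro hl
  have h1 : LinearIndependent ℝ ![a, b] := by
    apply LinearIndependent.of_comp f
    convert hl using 1
    funext i
    fin_cases i <;> rfl
  have := h1.fintype_card_le_finrank
  simp at this
  omega

lemma sub_dep {M N : Type*} [AddCommGroup M] [Module ℝ M] [AddCommGroup N] [Module ℝ N]
    (W : Submodule ℝ M) [Module.Finite ℝ W] (L : W →ₗ[ℝ] N)
    (hk : Module.finrank ℝ (LinearMap.ker L) = 1) {p q : M} (hp : p ∈ W) (hq : q ∈ W)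
    (h1 : L ⟨p, hp⟩ = 0) (h2 : L ⟨q, hq⟩ = 0) : ¬ LinearIndependent ℝ ![p, q] :=
  one_dim_dep (W.subtype ∘ₗ (LinearMap.ker L).subtype) hk ⟨_, h1⟩ ⟨_, h2⟩

lemma ker_dep {d : ℕ} {ι : Type} (v : ι → Fin 3 → ℝ)
    (hk : Module.finrank ℝ (LinearMap.ker (evL d v)) = 1)
    {p q : MvPolynomial (Fin 3) ℝ} (hp : p.IsHomogeneous d)
    (hq : q.IsHomogeneous d) (hpT : ∀ i, eval (v i) p = 0) (hqT : ∀ i, eval (v i) q = 0) :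
    ¬ LinearIndependent ℝ ![p, q] := by
  have h1 : evL d v ⟨p, hp⟩ = 0 := by
    funext i; rw [evL_apply]; exact hpT i
  have h2 : evL d v ⟨q, hq⟩ = 0 := by
    funext i; rw [evL_apply]; exact hqT i
  exact sub_dep (homogeneousSubmodule (Fin 3) ℝ d) (evL d v) hk hp hq h1 h2

lemma conic_dep {S : Set P2} (hS : NoFour S) (T : Finset P2) (hT : (T : Set P2) ⊆ S)
    (hc : 5 ≤ T.card) {p q : MvPolynomial (Fin 3) ℝ} (hp : p.IsHomogeneous 2)
    (hq : q.IsHomogeneous 2) (hpT : ∀ P ∈ T, eval P.rep p = 0) (hqT : ∀ P ∈ T, eval P.rep q = 0) :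
    ¬ LinearIndependent ℝ ![p, q] := by
  classical
  obtain ⟨U, hUT, hU⟩ := Finset.exists_subset_card_eq hc
  intro hli
  have hk := evL_ker 2 (fun i : U => i.1.rep) (by
    intro i
    obtain ⟨h, a, b, c⟩ := four_conic hS (hT (hUT i.2)) (U.erase i.1)
      (fun x hx => hT (hUT (Finset.mem_of_mem_erase hx))) (by simp)
      (by rw [Finset.card_erase_of_mem i.2]; omega)
    exact ⟨h, a, fun j hj => b _ (Finset.mem_erase.mpr ⟨fun e => hj (Subtype.ext e), j.2⟩), c⟩)
  rw [Fintype.card_coe, hU] at hk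
  have hk1 : Module.finrank ℝ (LinearMap.ker (evL 2 (fun i : U => i.1.rep))) = 1 := by
    have h6 : (2 + 2).choose 2 = 6 := by decide
    rw [h6] at hk
    exact Nat.succ_injective (Nat.succ_injective (Nat.succ_injective (Nat.succ_injective
      (Nat.succ_injective hk))))
  exact ker_dep _ hk1 hp hq (fun i => hpT _ (hUT i.2)) (fun i => hqT _ (hUT i.2)) hli

lemma lin_dvd {n : Fin 3 → ℝ} (hn : n ≠ 0) {c : MvPolynomial (Fin 3) ℝ}
    (hc : ∀ x, n ⬝ᵥ x = 0 → eval x c = 0) : lin n ∣ c := by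
  have hnn := dot_self_pos' hn
  let v : Fin 3 → ℝ := (n ⬝ᵥ n)⁻¹ • n
  let π : Fin 3 → MvPolynomial (Fin 3) ℝ := fun i => X i - C (v i) * lin n
  have h0 : aeval π c = 0 := by
    apply MvPolynomial.funext
    intro x
    have : eval x (aeval π c) = eval (x - (n ⬝ᵥ x) • v) c := by
      rw [aeval_def, hom_eval₂]
      simp only [eval, coe_eval₂Hom]
      congr 1
      · ext r; simp
      · funext i
        have := eval_lin n x
        simp only [eval, coe_eval₂Hom] at this
        simp [π, this, mul_comm]
    rw [this, map_zero]
    apply hc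
    simp [v, dotProduct_sub, hnn.ne']
  have h1 : (Ideal.Quotient.mk (Ideal.span {lin n})) c
      = (Ideal.Quotient.mk (Ideal.span {lin n})) (aeval π c) := by
    have : (Ideal.Quotient.mk (Ideal.span {lin n})) =
        (Ideal.Quotient.mk (Ideal.span {lin n})).comp (aeval π : _ →ₐ[ℝ] _).toRingHom := by
      apply MvPolynomial.ringHom_ext
      · intro r; simp
      · intro i
        have hl : (Ideal.Quotient.mk (Ideal.span {lin n})) (lin n) = 0 := by
          rw [Ideal.Quotient.eq_zero_iff_mem]; exact Ideal.mem_span_singleton_self _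
        simp [π, hl]
    exact congrArg (fun φ => φ c) this
  rw [h0, map_zero, Ideal.Quotient.eq_zero_iff_mem, Ideal.mem_span_singleton] at h1
  exact h1

lemma hom_two_bil {c : MvPolynomial (Fin 3) ℝ} (hc : c.IsHomogeneous 2) :
    ∃ N : Matrix (Fin 3) (Fin 3) ℝ, ∀ x y, eval (x + y) c = eval x c + eval y c +
      (N *ᵥ x) ⬝ᵥ y := by
  obtain ⟨M, hM⟩ := hom_two_eval hc
  refine ⟨Matrix.of fun i j => M i j + M j i, fun x y => ?_⟩
  rw [hM, hM, hM]
  simp [Fin.sum_univ_three, Matrix.mulVec, dotProduct]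
  ring

/-- a conic vanishing on a line has at most six points of S -/
lemma conic_line {S : Set P2} (hS : NoFour S) {c : MvPolynomial (Fin 3) ℝ}
    (hc : c.IsHomogeneous 2) (hc0 : c ≠ 0) {n : Fin 3 → ℝ} (hn : n ≠ 0)
    (hcn : ∀ x, n ⬝ᵥ x = 0 → eval x c = 0) (T : Finset P2) (hT : (T : Set P2) ⊆ S)
    (hcT : ∀ P ∈ T, eval P.rep c = 0) : T.card ≤ 6 := by
  classical
  obtain ⟨m, rfl⟩ := lin_dvd hn hcn
  obtain ⟨i, j, hij, h1, h2⟩ := hom_factor hc hc0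
  have hl : lin n ≠ 0 := left_ne_zero_of_mul hc0
  have hm : m ≠ 0 := right_ne_zero_of_mul hc0
  have hi : i = 1 := h1.inj_right (lin_hom n) hl
  have hj : j = 1 := by omega
  subst hj
  obtain ⟨n', rfl⟩ := hom_one_eq_lin h2
  have hn' : n' ≠ 0 := by rintro rfl; exact hm lin_zero
  have a1 := hS n hn (T.filter fun P => n ⬝ᵥ P.rep = 0)
    (fun x hx => hT (Finset.mem_of_mem_filter _ hx)) (fun P hP => (Finset.mem_filter.mp hP).2)
  have a2 := hS n' hn' (T.filter fun P => n' ⬝ᵥ P.rep = 0)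
    (fun x hx => hT (Finset.mem_of_mem_filter _ hx)) (fun P hP => (Finset.mem_filter.mp hP).2)
  have hu : T ⊆ (T.filter fun P => n ⬝ᵥ P.rep = 0) ∪ (T.filter fun P => n' ⬝ᵥ P.rep = 0) := by
    intro P hP
    have := hcT P hP
    rw [map_mul, eval_lin, eval_lin, mul_eq_zero] at this
    simp [hP, this]
  have := (Finset.card_le_card hu).trans (Finset.card_union_le _ _)
  omega

lemma conic_lt {g : MvPolynomial (Fin 3) ℝ} (hg : g.IsHomogeneous 6) (hp : Psd g)
    (hfin : (VR g).Finite) {S : Set P2} (hS : NoFour S) (hSg : S ⊆ VR g)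
    {c : MvPolynomial (Fin 3) ℝ}
    (hc : c.IsHomogeneous 2) (hc0 : c ≠ 0) (T : Finset P2) (hT : (T : Set P2) ⊆ S)
    (hcT : ∀ P ∈ T, eval P.rep c = 0) : T.card < 8 := by
  classical
  by_contra! hcard
  obtain ⟨N, hN⟩ := hom_two_bil hc
  obtain ⟨A, hA⟩ : T.Nonempty := Finset.card_pos.mp (by omega)
  set a := A.rep with ha
  have ha0 : a ≠ 0 := A.rep_nonzero
  have hsym : ∀ x y, (N *ᵥ x) ⬝ᵥ y = (N *ᵥ y) ⬝ᵥ x := by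
    intro x y
    have h1 := hN x y
    have h2 := hN y x
    rw [add_comm y x] at h2
    linarith
  have hca : eval a c = 0 := hcT A hA
  have hba : (N *ᵥ a) ⬝ᵥ a = 0 := by
    have h1 := hN a a
    have h2 := hom_eval_smul hc 2 a
    rw [two_smul] at h2
    rw [h2, hca] at h1
    linarith
  set b := N *ᵥ a with hb
  have hbP : ∀ P ∈ T, P ≠ A → b ⬝ᵥ P.rep ≠ 0 := by
    intro P hP hPA h0
    have hcr := cross_rep_ne hPA.symm
    rw [← ha] at hcr
    have := conic_line hS hc hc0 hcr (fun x hx => by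
      have htr : (a ⨯₃ P.rep) ⬝ᵥ (a ⨯₃ P.rep) ≠ 0 := (dot_self_pos' hcr).ne'
      obtain ⟨r, s, t, rfl⟩ := triple_span htr x
      have hr : r = 0 := by
        simp only [dotProduct_add, dotProduct_smul, smul_eq_mul] at hx
        rw [dotProduct_comm _ a, dotProduct_comm _ P.rep, dot_self_cross, dot_cross_self] at hx
        simpa [hcr] using hx
      subst hr
      rw [zero_smul, zero_add, hN, hom_eval_smul hc, hom_eval_smul hc, hca, hcT P hP,
        Matrix.mulVec_smul, ← hb, smul_dotProduct, dotProduct_smul, h0]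
      simp) T hT hcT
    omega
  obtain ⟨P₀, hP₀⟩ : (T.erase A).Nonempty := Finset.card_pos.mp (by
    rw [Finset.card_erase_of_mem hA]; omega)
  have hP₀' := hbP P₀ (Finset.mem_of_mem_erase hP₀) (Finset.ne_of_mem_erase hP₀)
  obtain ⟨u, hu⟩ : ∃ u, b ⬝ᵥ u = 1 := ⟨(b ⬝ᵥ P₀.rep)⁻¹ • P₀.rep, by simp [hP₀']⟩
  set w := b ⨯₃ a with hw
  have hbw : b ⬝ᵥ w = 0 := by rw [hw]; simp
  have htr : u ⬝ᵥ (w ⨯₃ a) ≠ 0 := by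
    have : u ⬝ᵥ (w ⨯₃ a) = (b ⬝ᵥ a) * (u ⬝ᵥ a) - (a ⬝ᵥ a) * (b ⬝ᵥ u) := by
      rw [hw]
      simp [cross_apply, dotProduct, Fin.sum_univ_three]; ring
    rw [this, hba, hu]
    have := dot_self_pos' ha0
    intro h; linarith
  have hline : ∀ t s : ℝ, eval (u + t • w + s • a) c = eval (u + t • w) c + s := by
    intro t s
    rw [hN, hsym, Matrix.mulVec_smul, ← hb, hom_eval_smul hc, hca, smul_dotProduct,
      dotProduct_add, dotProduct_smul, hu, hbw]
    simp
  have hquad : ∀ t : ℝ, eval (u + t • w) c = eval u c + t ^ 2 * eval w c + t * ((N *ᵥ u) ⬝ᵥ w) := by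
    intro t
    rw [hN, hom_eval_smul hc, dotProduct_smul, smul_eq_mul]
  have key : ∀ P ∈ T.erase A, ∃ t x : ℝ, x ≠ 0 ∧
      P.rep = x • (u + t • w + (- eval (u + t • w) c) • a) := by
    intro P hP
    have hPT := Finset.mem_of_mem_erase hP
    obtain ⟨x, y, z, hxyz⟩ := triple_span htr P.rep
    have hx : x ≠ 0 := by
      have h1 := hbP P hPT (Finset.ne_of_mem_erase hP)
      rw [hxyz] at h1
      simpa [dotProduct_add, hu, hbw, hba] using h1
    have h2 : P.rep = x • (u + (y / x) • w + (z / x) • a) := by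
      rw [hxyz, smul_add, smul_add, smul_smul, smul_smul, mul_div_cancel₀ _ hx,
        mul_div_cancel₀ _ hx]
    have h3 := hcT P hPT
    rw [h2, hom_eval_smul hc, hline] at h3
    have h4 := (mul_eq_zero.mp h3).resolve_left (pow_ne_zero _ hx)
    refine ⟨y / x, x, hx, ?_⟩
    rw [h2, show - eval (u + (y / x) • w) c = z / x by linarith]
  choose! t x hx hPt using key
  have hinj : Set.InjOn t (T.erase A) := by
    intro P hP Q hQ h
    refine eq_of_rep_smul (hPt P hP) (by rw [h]; exact hPt Q hQ)
  let φ : Fin 3 → Polynomial ℝ := fun i => Polynomial.C (u i) + Polynomial.C (w i) * Polynomial.X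
    - Polynomial.C (a i) * (Polynomial.C (eval u c) + Polynomial.X ^ 2 * Polynomial.C (eval w c)
      + Polynomial.X * Polynomial.C ((N *ᵥ u) ⬝ᵥ w))
  have hφ : ∀ s : ℝ, (fun i => (φ i).eval s) = u + s • w + (- eval (u + s • w) c) • a := by
    intro s
    rw [hquad]
    ext i
    simp only [φ, Polynomial.eval_add, Polynomial.eval_sub, Polynomial.eval_mul,
      Polynomial.eval_C, Polynomial.eval_X, Polynomial.eval_pow, Pi.add_apply, Pi.smul_apply,
      smul_eq_mul]
    ring
  have hall := poly_curve (e := 2) hg hp φ (fun i => by simp only [φ]; compute_degree)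
    ((T.erase A).image t)
    (by
      intro s hs
      obtain ⟨P, hP, rfl⟩ := Finset.mem_image.mp hs
      rw [hφ]
      have h1 := hSg (hT (Finset.mem_of_mem_erase hP))
      change eval P.rep g = 0 at h1
      rw [hPt P hP, hom_eval_smul hg] at h1
      exact (mul_eq_zero.mp h1).resolve_left (pow_ne_zero _ (hx P hP)))
    (by rw [Finset.card_image_of_injOn hinj, Finset.card_erase_of_mem hA]; omega)
  refine curve_infinite hg htr (fun s => - eval (u + s • w) c) (fun s => ?_) hfin
  have := hall s
  rw [hφ] at this
  exact this

lemma lin_pair_unique {n n' : Fin 3 → ℝ} (hli : LinearIndependent ℝ ![lin n, lin n'])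
    {A B : P2} (h1 : n ⬝ᵥ A.rep = 0) (h2 : n ⬝ᵥ B.rep = 0) (h3 : n' ⬝ᵥ A.rep = 0)
    (h4 : n' ⬝ᵥ B.rep = 0) : A = B := by
  by_contra hAB
  obtain ⟨v, hv⟩ := exists_triple2 (cross_rep_ne hAB)
  rw [LinearIndependent.pair_iff] at hli
  have key := hli (n' ⬝ᵥ v) (-(n ⬝ᵥ v)) (by
    apply MvPolynomial.funext
    intro x
    obtain ⟨r, s, t, rfl⟩ := triple_span hv x
    simp only [map_add, smul_eq_C_mul, map_mul, eval_C, eval_lin, dotProduct_add, dotProduct_smul,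
      h1, h2, h3, h4, smul_eq_mul, map_zero]
    ring)
  have h0 := hli 1 0 (by
    apply MvPolynomial.funext
    intro x
    obtain ⟨r, s, t, rfl⟩ := triple_span hv x
    have : n ⬝ᵥ v = 0 := by linarith [key.2]
    simp only [map_add, smul_eq_C_mul, map_mul, eval_C, eval_lin, dotProduct_add, dotProduct_smul,
      h1, h2, h3, h4, smul_eq_mul, map_zero, this]
    ring)
  exact one_ne_zero h0.1

lemma syz {g : MvPolynomial (Fin 3) ℝ} (hg : g.IsHomogeneous 6) (hpsd : Psd g)
    (hfin : (VR g).Finite) {S : Set P2} (hS : NoFour S) (hSg : S ⊆ VR g)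
    (T : Finset P2) (hT : (T : Set P2) ⊆ S) (hT9 : T.card = 9)
    {p q : MvPolynomial (Fin 3) ℝ} (hp : p.IsHomogeneous 3)
    (hq : q.IsHomogeneous 3) (hpT : ∀ P ∈ T, eval P.rep p = 0) (hqT : ∀ P ∈ T, eval P.rep q = 0)
    (hli : LinearIndependent ℝ ![p, q]) {a b : MvPolynomial (Fin 3) ℝ} (ha : a.IsHomogeneous 3)
    (hab : a * p + b * q = 0) :
    ∃ k : ℝ, a = C k * q ∧ b = -(C k * p) := by
  classical
  have hli0 := hli
  rw [LinearIndependent.pair_iff] at hli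
  have hp0 : p ≠ 0 := by
    rintro rfl
    exact one_ne_zero (hli 1 0 (by simp)).1
  have hq0 : q ≠ 0 := by
    rintro rfl
    exact one_ne_zero (hli 0 1 (by simp)).2
  obtain ⟨p', q', c, hrel, hcp, hcq⟩ := UniqueFactorizationMonoid.exists_reduced_factors p hp0 q
  subst hcp hcq
  have hc0 : c ≠ 0 := left_ne_zero_of_mul hp0
  have hp'0 : p' ≠ 0 := right_ne_zero_of_mul hp0
  have hq'0 : q' ≠ 0 := right_ne_zero_of_mul hq0
  have hli' : LinearIndependent ℝ ![p', q'] := by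
    rw [LinearIndependent.pair_iff]
    intro s t hst
    apply hli
    rw [← mul_smul_comm, ← mul_smul_comm, ← mul_add, hst, mul_zero]
  obtain ⟨i, j, hij, hci, hpj⟩ := hom_factor hp hp0
  obtain ⟨i', j', hij', hci', hqj⟩ := hom_factor hq hq0
  have hii : i' = i := hci'.inj_right hci hc0
  have hjj : j' = j := by omega
  subst hii hjj
  have hi : i' ≤ 3 := by omega
  interval_cases i'
  · -- constant gcd
    obtain ⟨γ, rfl⟩ := hom_zero_const hci
    have hγ : γ ≠ 0 := by rintro rfl; simp at hc0
    have h1 : a * p' + b * q' = 0 := by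
      apply (mul_eq_zero.mp (_ : C γ * _ = 0)).resolve_left hc0
      linear_combination hab
    have h2 : q' ∣ a := by
      apply hrel.symm.dvd_of_dvd_mul_right
      exact ⟨-b, by linear_combination h1⟩
    obtain ⟨m, hm⟩ := h2
    have hk : ∃ k : ℝ, a = C k * (C γ * q') := by
      by_cases ha0 : a = 0
      · exact ⟨0, by simp [ha0]⟩
      · rw [hm] at ha ha0
        obtain ⟨i, l, hil, h3, h4⟩ := hom_factor ha ha0
        have : i = j' := h3.inj_right hqj hq'0
        have hl : l = 0 := by omega
        subst hl
        obtain ⟨μ, rfl⟩ := hom_zero_const h4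
        refine ⟨μ / γ, ?_⟩
        rw [hm, ← mul_assoc, ← C_mul, div_mul_cancel₀ _ hγ, mul_comm]
    obtain ⟨k, hk⟩ := hk
    refine ⟨k, hk, ?_⟩
    apply mul_right_cancel₀ hq0
    rw [hk] at hab
    linear_combination hab
  · exfalso
    obtain ⟨n, rfl⟩ := hom_one_eq_lin hci
    have hn : n ≠ 0 := by rintro rfl; exact hc0 lin_zero
    have hj : j' = 2 := by omega
    subst hj
    have h1 := hS n hn (T.filter fun P => n ⬝ᵥ P.rep = 0)
      (fun x hx => hT (Finset.mem_of_mem_filter _ hx)) (fun P hP => (Finset.mem_filter.mp hP).2)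
    have h2 := Finset.card_filter_add_card_filter_not (s := T) (fun P : P2 => n ⬝ᵥ P.rep = 0)
    refine conic_dep hS (T.filter fun P => ¬ n ⬝ᵥ P.rep = 0)
      (fun x hx => hT (Finset.mem_of_mem_filter _ hx)) (by omega) hpj hqj ?_ ?_ hli'
    · intro P hP
      obtain ⟨hPT, hPn⟩ := Finset.mem_filter.mp hP
      have := hpT P hPT
      rw [map_mul, eval_lin] at this
      exact (mul_eq_zero.mp this).resolve_left hPn
    · intro P hP
      obtain ⟨hPT, hPn⟩ := Finset.mem_filter.mp hP
      have := hqT P hPT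
      rw [map_mul, eval_lin] at this
      exact (mul_eq_zero.mp this).resolve_left hPn
  · exfalso
    have hj : j' = 1 := by omega
    subst hj
    obtain ⟨n, rfl⟩ := hom_one_eq_lin hpj
    obtain ⟨n', rfl⟩ := hom_one_eq_lin hqj
    have h1 := conic_lt hg hpsd hfin hS hSg hci hc0 (T.filter fun P => eval P.rep c = 0)
      (fun x hx => hT (Finset.mem_of_mem_filter _ hx)) (fun P hP => (Finset.mem_filter.mp hP).2)
    have h2 := Finset.card_filter_add_card_filter_not (s := T) (fun P : P2 => eval P.rep c = 0)
    have h3 : 1 < (T.filter fun P => ¬ eval P.rep c = 0).card := by omega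
    obtain ⟨A, hA, B, hB, hAB⟩ := Finset.one_lt_card.mp h3
    have hz : ∀ P ∈ T.filter (fun P => ¬ eval P.rep c = 0), n ⬝ᵥ P.rep = 0 ∧ n' ⬝ᵥ P.rep = 0 := by
      intro P hP
      obtain ⟨hPT, hPn⟩ := Finset.mem_filter.mp hP
      have e1 := hpT P hPT
      have e2 := hqT P hPT
      rw [map_mul, eval_lin] at e1 e2
      exact ⟨(mul_eq_zero.mp e1).resolve_left hPn, (mul_eq_zero.mp e2).resolve_left hPn⟩
    exact hAB (lin_pair_unique hli' (hz A hA).1 (hz B hB).1 (hz A hA).2 (hz B hB).2)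
  · exfalso
    have hj : j' = 0 := by omega
    subst hj
    obtain ⟨α, rfl⟩ := hom_zero_const hpj
    obtain ⟨β, rfl⟩ := hom_zero_const hqj
    rw [LinearIndependent.pair_iff] at hli'
    have := hli' β (-α) (by
      rw [smul_eq_C_mul, smul_eq_C_mul, ← C_mul, ← C_mul, ← C_add]
      simp; ring)
    apply hp'0
    rw [show α = 0 by linarith [this.2], C_0]

/-- the quartic vanishing on all points but one -/
lemma eight_quartic {S : Set P2} (hS : NoFour S) (T : Finset P2) (hT : (T : Set P2) ⊆ S)
    (hT9 : T.card = 9) {P : P2} (hP : P ∈ T) :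
    ∃ h : MvPolynomial (Fin 3) ℝ, h.IsHomogeneous 4 ∧ (∀ Q ∈ T, Q ≠ P → eval Q.rep h = 0) ∧
      eval P.rep h ≠ 0 := by
  classical
  have h8 : (T.erase P).card = 8 := by rw [Finset.card_erase_of_mem hP]; omega
  obtain ⟨U, hUT, hU⟩ := Finset.exists_subset_card_eq (show 4 ≤ (T.erase P).card by omega)
  have hTS : ∀ x ∈ T.erase P, x ∈ S := fun x hx => hT (Finset.mem_of_mem_erase hx)
  obtain ⟨h1, a1, b1, c1⟩ := four_conic hS (hT hP) U (fun x hx => hTS x (hUT hx))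
    (fun h => by simpa using hUT h) hU
  obtain ⟨h2, a2, b2, c2⟩ := four_conic hS (hT hP) (T.erase P \ U)
    (fun x hx => hTS x (Finset.mem_sdiff.mp hx).1)
    (fun h => by simpa using (Finset.mem_sdiff.mp h).1)
    (by rw [Finset.card_sdiff_of_subset hUT]; omega)
  refine ⟨h1 * h2, a1.mul a2, ?_, ?_⟩
  · intro Q hQ hQP
    rw [map_mul]
    by_cases hQU : Q ∈ U
    · rw [b1 Q hQU, zero_mul]
    · rw [b2 Q (Finset.mem_sdiff.mpr ⟨Finset.mem_erase.mpr ⟨hQP, hQ⟩, hQU⟩), mul_zero]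
  · rw [map_mul]; exact mul_ne_zero c1 c2

/-- multiplication map -/
def mulMap {p q : MvPolynomial (Fin 3) ℝ} (hp : p.IsHomogeneous 3) (hq : q.IsHomogeneous 3) :
    (homogeneousSubmodule (Fin 3) ℝ 3 × homogeneousSubmodule (Fin 3) ℝ 3) →ₗ[ℝ]
      homogeneousSubmodule (Fin 3) ℝ 6 where
  toFun x := ⟨x.1.1 * p + x.2.1 * q,
    (IsHomogeneous.mul x.1.2 hp).add (IsHomogeneous.mul x.2.2 hq)⟩
  map_add' x y := by
    apply Subtype.ext
    simp
    ring
  map_smul' r x := by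
    apply Subtype.ext
    simp [smul_add]

lemma span_le_one {V : Type*} [AddCommGroup V] [Module ℝ V] (v : V) :
    Module.finrank ℝ (Submodule.span ℝ {v}) ≤ 1 := by
  have := finrank_span_le_card (R := ℝ) ({v} : Set V)
  simpa using this

lemma ideal_six {g : MvPolynomial (Fin 3) ℝ} (hg : g.IsHomogeneous 6) (hpsd : Psd g)
    (hfin : (VR g).Finite) {S : Set P2} (hS : NoFour S) (hSg : S ⊆ VR g)
    (T : Finset P2) (hT : (T : Set P2) ⊆ S) (hT9 : T.card = 9)
    {p q : MvPolynomial (Fin 3) ℝ} (hp : p.IsHomogeneous 3)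
    (hq : q.IsHomogeneous 3) (hpT : ∀ P ∈ T, eval P.rep p = 0) (hqT : ∀ P ∈ T, eval P.rep q = 0)
    (hli : LinearIndependent ℝ ![p, q]) {f : MvPolynomial (Fin 3) ℝ} (hf : f.IsHomogeneous 6)
    (hfT : ∀ P ∈ T, eval P.rep f = 0) :
    ∃ a b : MvPolynomial (Fin 3) ℝ, a.IsHomogeneous 3 ∧ b.IsHomogeneous 3 ∧
      f = a * p + b * q := by
  classical
  have hk := evL_ker 6 (fun i : T => i.1.rep) (by
    intro i
    obtain ⟨h, a, b, c⟩ := eight_quartic hS T hT hT9 i.2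
    refine ⟨h * (lin i.1.rep * lin i.1.rep), a.mul ((lin_hom _).mul (lin_hom _)), ?_, ?_⟩
    · intro j hj
      rw [map_mul, b j.1 j.2 (fun e => hj (Subtype.ext e)), zero_mul]
    · rw [map_mul, map_mul, eval_lin]
      have := dot_self_pos' i.1.rep_nonzero
      exact mul_ne_zero c (mul_ne_zero this.ne' this.ne'))
  rw [Fintype.card_coe, hT9] at hk
  norm_num [Nat.choose] at hk
  have hle : LinearMap.range (mulMap hp hq) ≤ LinearMap.ker (evL 6 (fun i : T => i.1.rep)) := by
    rintro _ ⟨x, rfl⟩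
    rw [LinearMap.mem_ker]
    ext i
    rw [evL_apply]
    simp [mulMap, hpT _ i.2, hqT _ i.2]
  have hker : LinearMap.ker (mulMap hp hq) ≤ Submodule.span ℝ
      {((⟨q, hq⟩, -⟨p, hp⟩) :
        homogeneousSubmodule (Fin 3) ℝ 3 × homogeneousSubmodule (Fin 3) ℝ 3)} := by
    intro x hx
    rw [LinearMap.mem_ker] at hx
    have hx' := congrArg Subtype.val hx
    obtain ⟨k, h1, h2⟩ := syz hg hpsd hfin hS hSg T hT hT9 hp hq hpT hqT hli x.1.2 hx'
    rw [Submodule.mem_span_singleton]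
    refine ⟨k, ?_⟩
    ext1
    · apply Subtype.ext
      simp [h1, smul_eq_C_mul]
    · apply Subtype.ext
      simp [h2, smul_eq_C_mul]
  have hk1 : Module.finrank ℝ (LinearMap.ker (mulMap hp hq)) ≤ 1 :=
    (Submodule.finrank_mono hker).trans (span_le_one _)
  have hr := LinearMap.finrank_range_add_finrank_ker (mulMap hp hq)
  rw [Module.finrank_prod, finrank_hom] at hr
  norm_num [Nat.choose] at hr
  have heq := Submodule.eq_of_le_of_finrank_le hle (by omega)
  have hmem : (⟨f, hf⟩ : homogeneousSubmodule (Fin 3) ℝ 6) ∈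
      LinearMap.ker (evL 6 (fun i : T => i.1.rep)) := by
    rw [LinearMap.mem_ker]; ext i; rw [evL_apply]; exact hfT _ i.2
  rw [← heq] at hmem
  obtain ⟨x, hx⟩ := hmem
  exact ⟨x.1.1, x.2.1, x.1.2, x.2.2, (congrArg Subtype.val hx).symm⟩

lemma grad_mul {p a : MvPolynomial (Fin 3) ℝ} {P : Fin 3 → ℝ} (h : eval P p = 0) (i : Fin 3) :
    eval P (pderiv i (a * p)) = eval P a * eval P (pderiv i p) := by
  simp [Derivation.leibniz, h]

lemma two_squares {α β γ : ℝ} (h : ∀ s t : ℝ, 0 ≤ α * s ^ 2 + β * (s * t) + γ * t ^ 2) :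
    ∃ a b c : ℝ, α = a ^ 2 ∧ β = 2 * a * b ∧ γ = b ^ 2 + c ^ 2 := by
  have h1 := h 1 0
  have h2 := h 0 1
  simp at h1 h2
  rcases h1.eq_or_lt with h0 | h0
  · subst h0
    have hβ : β = 0 := by
      have e1 := h (-(γ + 1)) β
      have e2 : 0 ≤ -β ^ 2 := by nlinarith
      have := sq_nonneg β
      exact pow_eq_zero_iff (two_ne_zero) |>.mp (by linarith)
    exact ⟨0, 0, Real.sqrt γ, by simp, by simp [hβ], by rw [Real.sq_sqrt h2]; ring⟩
  · have hs := Real.sqrt_pos.mpr h0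
    have hd : 0 ≤ γ - (β / (2 * Real.sqrt α)) ^ 2 := by
      have e := h (-β) (2 * α)
      rw [div_pow, mul_pow, Real.sq_sqrt h0.le, sub_nonneg, div_le_iff₀ (by positivity)]
      by_contra! hc
      nlinarith
    refine ⟨Real.sqrt α, β / (2 * Real.sqrt α), Real.sqrt (γ - (β / (2 * Real.sqrt α)) ^ 2),
      (Real.sq_sqrt h0.le).symm, by field_simp, by rw [Real.sq_sqrt hd]; ring⟩

lemma not_unit_of_hom {f : MvPolynomial (Fin 3) ℂ} (hf : f.IsHomogeneous 3) : ¬ IsUnit f := by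
  intro hu
  have h0 : f ≠ 0 := hu.ne_zero
  have h1 := hf.totalDegree h0
  obtain ⟨r, -, hr⟩ := MvPolynomial.isUnit_iff_eq_C_of_isReduced.mp hu
  rw [hr, totalDegree_C] at h1
  omega

lemma not_irred {c₁ c₂ : MvPolynomial (Fin 3) ℝ} (h1 : c₁.IsHomogeneous 3)
    (h2 : c₂.IsHomogeneous 3) :
    ¬ Irreducible (MvPolynomial.map (algebraMap ℝ ℂ) (c₁ ^ 2 + c₂ ^ 2)) := by
  intro h
  have hI : (C Complex.I : MvPolynomial (Fin 3) ℂ) * C Complex.I = -1 := by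
    rw [← C_mul, Complex.I_mul_I]; simp
  have e : MvPolynomial.map (algebraMap ℝ ℂ) (c₁ ^ 2 + c₂ ^ 2) =
      (MvPolynomial.map (algebraMap ℝ ℂ) c₁ + C Complex.I * MvPolynomial.map (algebraMap ℝ ℂ) c₂) *
      (MvPolynomial.map (algebraMap ℝ ℂ) c₁ - C Complex.I * MvPolynomial.map (algebraMap ℝ ℂ) c₂) := by
    simp only [map_add, map_pow]
    linear_combination (MvPolynomial.map (algebraMap ℝ ℂ) c₂) ^ 2 * hI
  have m1 := h1.map (algebraMap ℝ ℂ)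
  have m2 := (h2.map (algebraMap ℝ ℂ)).C_mul Complex.I
  rcases h.isUnit_or_isUnit e with hu | hu
  · exact not_unit_of_hom (m1.add m2) hu
  · exact not_unit_of_hom (m1.sub m2) hu

theorem statement6 (g : MvPolynomial (Fin 3) ℝ) (hg6 : g.IsHomogeneous 6) (hpsd : Psd g)
    (hfin : (VR g).Finite) (S : Set P2) (hSsub : S ⊆ VR g) (hS9 : S.encard = 9)
    (hdim : Module.finrank ℝ (Isub 3 S) = 2) :
    (∃ c₁ c₂ : MvPolynomial (Fin 3) ℝ, c₁.IsHomogeneous 3 ∧ c₂.IsHomogeneous 3 ∧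
      g = c₁ ^ 2 + c₂ ^ 2) ∧
    ¬ Irreducible (MvPolynomial.map (algebraMap ℝ ℂ) g) := by
  classical
  suffices hmain : ∃ c₁ c₂ : MvPolynomial (Fin 3) ℝ, c₁.IsHomogeneous 3 ∧ c₂.IsHomogeneous 3 ∧
      g = c₁ ^ 2 + c₂ ^ 2 by
    refine ⟨hmain, ?_⟩
    obtain ⟨c₁, c₂, h1, h2, rfl⟩ := hmain
    exact not_irred h1 h2
  have hSfin : S.Finite := hfin.subset hSsub
  have hS : NoFour S := fun n hn T hT hTn =>
    line_le hg6 hpsd hfin hn T (fun P hP => hSsub (hT hP)) hTn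
  obtain ⟨T, rfl⟩ : ∃ T : Finset P2, S = (T : Set P2) := ⟨hSfin.toFinset, by simp⟩
  have hT9 : T.card = 9 := by
    rw [Set.encard_coe_eq_coe_finsetCard] at hS9
    exact_mod_cast hS9
  have : Module.Finite ℝ (Isub 3 (T : Set P2)) := Module.finite_of_finrank_pos (by omega)
  let B := Module.finBasisOfFinrankEq ℝ (Isub 3 (T : Set P2)) hdim
  obtain ⟨p, hpB⟩ : ∃ p : MvPolynomial (Fin 3) ℝ, p = (B 0).1 := ⟨_, rfl⟩
  obtain ⟨q, hqB⟩ : ∃ q : MvPolynomial (Fin 3) ℝ, q = (B 1).1 := ⟨_, rfl⟩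
  have hp : p.IsHomogeneous 3 := hpB ▸ (B 0).2.1
  have hq : q.IsHomogeneous 3 := hqB ▸ (B 1).2.1
  have hpT : ∀ P ∈ T, eval P.rep p = 0 := by
    intro P hP; rw [hpB]; exact (B 0).2.2 P hP
  have hqT : ∀ P ∈ T, eval P.rep q = 0 := by
    intro P hP; rw [hqB]; exact (B 1).2.2 P hP
  have hli : LinearIndependent ℝ ![p, q] := by
    rw [LinearIndependent.pair_iff]
    intro s t hst
    have h1 := Fintype.linearIndependent_iff.mp B.linearIndependent ![s, t] (by
      rw [Fin.sum_univ_two]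
      apply Subtype.ext
      simpa [hpB, hqB] using hst)
    exact ⟨h1 0, h1 1⟩
  have hspan : ∀ f : MvPolynomial (Fin 3) ℝ, f.IsHomogeneous 3 → (∀ P ∈ T, eval P.rep f = 0) →
      ∃ s t : ℝ, f = C s * p + C t * q := by
    intro f hf hfT
    have := B.sum_repr ⟨f, ⟨hf, hfT⟩⟩
    rw [Fin.sum_univ_two] at this
    have := congrArg Subtype.val this
    refine ⟨B.repr ⟨f, ⟨hf, hfT⟩⟩ 0, B.repr ⟨f, ⟨hf, hfT⟩⟩ 1, ?_⟩
    rw [← smul_eq_C_mul, ← smul_eq_C_mul, hpB, hqB]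
    exact this.symm
  have hideal : ∀ f : MvPolynomial (Fin 3) ℝ, f.IsHomogeneous 6 → (∀ P ∈ T, eval P.rep f = 0) →
      ∃ a b : MvPolynomial (Fin 3) ℝ, a.IsHomogeneous 3 ∧ b.IsHomogeneous 3 ∧
      f = a * p + b * q := fun f hf hfT =>
    ideal_six hg6 hpsd hfin hS hSsub T subset_rfl hT9 hp hq hpT hqT hli hf hfT
  -- transversality
  have htrans : ∀ P ∈ T, ∀ x y : ℝ,
      (∀ i, x * eval P.rep (pderiv i p) + y * eval P.rep (pderiv i q) = 0) → x = 0 ∧ y = 0 := by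
    intro P hP x y hxy
    obtain ⟨h, hh, hh0, hhP⟩ := eight_quartic hS T subset_rfl hT9 hP
    obtain ⟨v, w, hvw⟩ := exists_triple P.rep_nonzero
    have hn : ∀ v : Fin 3 → ℝ, ∃ a b k : ℝ, k ≠ 0 ∧ ∀ i,
        k * (P.rep ⨯₃ v) i = a * eval P.rep (pderiv i p) + b * eval P.rep (pderiv i q) := by
      intro v
      have hv0 : eval P.rep (lin (P.rep ⨯₃ v)) = 0 := by
        rw [eval_lin, dotProduct_comm, dot_self_cross]
      obtain ⟨a, b, -, -, hab⟩ := hideal ((h * lin P.rep) * lin (P.rep ⨯₃ v))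
        ((hh.mul (lin_hom _)).mul (lin_hom _)) (by
          intro Q hQ
          by_cases hQP : Q = P
          · rw [hQP, map_mul, hv0, mul_zero]
          · rw [map_mul, map_mul, hh0 Q hQ hQP]; ring)
      refine ⟨eval P.rep a, eval P.rep b, eval P.rep (h * lin P.rep), ?_, fun i => ?_⟩
      · rw [map_mul, eval_lin]
        exact mul_ne_zero hhP (dot_self_pos' P.rep_nonzero).ne'
      · have e := congrArg (fun f => eval P.rep (pderiv i f)) hab
        simp only [map_add] at e
        rw [grad_mul hv0, grad_mul (hpT P hP), grad_mul (hqT P hP), pderiv_lin, eval_C] at e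
        exact e
    obtain ⟨a, b, k, hk, h1⟩ := hn v
    obtain ⟨a', b', k', hk', h2⟩ := hn w
    set Dp : Fin 3 → ℝ := fun i => eval P.rep (pderiv i p) with hDp
    set Dq : Fin 3 → ℝ := fun i => eval P.rep (pderiv i q) with hDq
    have h1' : k • (P.rep ⨯₃ v) = a • Dp + b • Dq := funext h1
    have h2' : k' • (P.rep ⨯₃ w) = a' • Dp + b' • Dq := funext h2
    have hcr : (k • (P.rep ⨯₃ v)) ⨯₃ (k' • (P.rep ⨯₃ w)) =
        (k * k' * (P.rep ⬝ᵥ (v ⨯₃ w))) • P.rep := by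
      ext i
      fin_cases i <;> simp [cross_apply, dotProduct, Fin.sum_univ_three] <;> ring
    have hcr2 : (a • Dp + b • Dq) ⨯₃ (a' • Dp + b' • Dq) = (a * b' - b * a') • (Dp ⨯₃ Dq) := by
      ext i
      fin_cases i <;> simp [cross_apply] <;> ring
    have hne : Dp ⨯₃ Dq ≠ 0 := by
      intro h0
      rw [h1', h2', hcr2, h0, smul_zero] at hcr
      have := hcr.symm
      rw [smul_eq_zero] at this
      rcases this with h3 | h3
      · exact (mul_ne_zero (mul_ne_zero hk hk') hvw) h3
      · exact P.rep_nonzero h3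
    rw [crossProduct_ne_zero_iff_linearIndependent, LinearIndependent.pair_iff] at hne
    exact hne x y (funext hxy)
  obtain ⟨a, b, ha, hb, hgab⟩ := hideal g hg6 (fun P hP => hSsub hP)
  have habT : ∀ P ∈ T, eval P.rep a = 0 ∧ eval P.rep b = 0 := by
    intro P hP
    apply htrans P hP
    intro i
    have e := grad_zero hpsd (hSsub hP : eval P.rep g = 0) i
    rw [hgab, map_add, map_add, grad_mul (hpT P hP), grad_mul (hqT P hP)] at e
    exact e
  obtain ⟨s₁, t₁, ha'⟩ := hspan a ha fun P hP => (habT P hP).1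
  obtain ⟨s₂, t₂, hb'⟩ := hspan b hb fun P hP => (habT P hP).2
  have hgev : ∀ u, eval u g = s₁ * eval u p ^ 2 + (t₁ + s₂) * (eval u p * eval u q)
      + t₂ * eval u q ^ 2 := by
    intro u
    rw [hgab, ha', hb']
    simp only [map_add, map_mul, eval_C]
    ring
  have hQ : ∀ s t : ℝ, 0 ≤ s₁ * s ^ 2 + (t₁ + s₂) * (s * t) + t₂ * t ^ 2 := by
    intro s t
    by_cases hst : s = 0 ∧ t = 0
    · rw [hst.1, hst.2]; simp
    have hf0 : C t * p - C s * q ≠ 0 := by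
      intro h0
      apply hst
      rw [LinearIndependent.pair_iff] at hli
      have := hli t (-s) (by
        rw [smul_eq_C_mul, smul_eq_C_mul, C_neg]; linear_combination h0)
      exact ⟨by linarith [this.2], this.1⟩
    have hinf := cubic_infinite ((hp.C_mul t).sub (hq.C_mul s)) hf0
    obtain ⟨P, hPf, hPg⟩ : ∃ P, P ∈ VR (C t * p - C s * q) ∧ P ∉ VR g := by
      by_contra! hcon
      exact hinf (hfin.subset hcon)
    have e1 : t * eval P.rep p = s * eval P.rep q := by
      have : eval P.rep (C t * p - C s * q) = 0 := hPf
      simp only [map_sub, map_mul, eval_C] at this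
      linarith
    have e2 : eval P.rep g ≠ 0 := hPg
    have e3 := hpsd P.rep
    rw [hgev] at e2 e3
    generalize eval P.rep p = x at *
    generalize eval P.rep q = y at *
    have hxy : 0 < x ^ 2 + y ^ 2 := by
      by_contra! hle
      have hx : x = 0 := by nlinarith [sq_nonneg x, sq_nonneg y]
      have hy : y = 0 := by nlinarith [sq_nonneg x, sq_nonneg y]
      apply e2; rw [hx, hy]; ring
    have key : (x ^ 2 + y ^ 2) * (s₁ * s ^ 2 + (t₁ + s₂) * (s * t) + t₂ * t ^ 2) =
        (s ^ 2 + t ^ 2) * (s₁ * x ^ 2 + (t₁ + s₂) * (x * y) + t₂ * y ^ 2) := by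
      linear_combination ((t₁ + s₂) * s * x + t₂ * (x * t + s * y) - s₁ * (y * s + t * x) - (t₁ + s₂) * t * y) * e1
    have hnn : 0 ≤ (s ^ 2 + t ^ 2) * (s₁ * x ^ 2 + (t₁ + s₂) * (x * y) + t₂ * y ^ 2) := by
      positivity
    rw [← key] at hnn
    exact nonneg_of_mul_nonneg_right hnn hxy
  obtain ⟨α, β, γ, h1, h2, h3⟩ := two_squares hQ
  refine ⟨C α * p + C β * q, C γ * q, (hp.C_mul _).add (hq.C_mul _), hq.C_mul _, ?_⟩
  apply MvPolynomial.funext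
  intro u
  rw [hgev, h1, h2, h3]
  simp only [map_add, map_mul, map_pow, eval_C]
  ring

end
end

section
/- Let g be a psd sextic form in ℝ[x₀,x₁,x₂] whose real projective zero set V_ℝ(g) is finite, and let S ⊂ V_ℝ(g) with |S| = 9. If the space I₃(S) of cubic forms vanishing at every point of S has dimension 1, then g is not a sum of squares of forms, and the image of g in ℂ[x₀,x₁,x₂] is irreducible. -/
open MvPolynomial

noncomputable section

namespace S7

/-- The grading homomorphism `X i ↦ X i * T`. -/
def theta : MvPolynomial (Fin 3) ℝ →ₐ[ℝ] Polynomial (MvPolynomial (Fin 3) ℝ) :=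
  MvPolynomial.aeval (fun i => Polynomial.C (X i) * Polynomial.X)

lemma theta_monomial (s : Fin 3 →₀ ℕ) (c : ℝ) :
    theta (monomial s c) = Polynomial.monomial s.degree (monomial s c) := by
  rw [theta, aeval_monomial, Finsupp.prod_fintype _ _ (by simp)]
  simp only [mul_pow, Finset.prod_mul_distrib, Finset.prod_pow_eq_pow_sum]
  rw [← Finsupp.degree_eq_sum, ← Polynomial.C_mul_X_pow_eq_monomial, ← mul_assoc]
  congr 1
  rw [monomial_eq, Finsupp.prod_fintype _ _ (by simp), map_mul, map_prod]
  simp only [map_pow]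
  rfl

lemma coeff_theta (h : MvPolynomial (Fin 3) ℝ) (k : ℕ) :
    (theta h).coeff k = homogeneousComponent k h := by
  induction h using MvPolynomial.induction_on' with
  | monomial s c =>
    rw [theta_monomial, Polynomial.coeff_monomial]
    split_ifs with hk
    · exact (homogeneousComponent_eq_self (isHomogeneous_monomial c hk)).symm
    · ext d
      rw [coeff_homogeneousComponent, coeff_monomial]
      split_ifs <;> simp_all
  | add p q hp hq => simp [hp, hq]

lemma isHomogeneous_of_theta {h : MvPolynomial (Fin 3) ℝ} {n : ℕ}
    (H : ∀ k, k ≠ n → homogeneousComponent k h = 0) : h.IsHomogeneous n := by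
  have := sum_homogeneousComponent h
  rw [← this]
  apply IsHomogeneous.sum
  intro i _
  by_cases hi : i = n
  · subst hi; exact homogeneousComponent_isHomogeneous _ _
  · rw [H i hi]; exact isHomogeneous_zero _ _ _

lemma theta_of_hom {h : MvPolynomial (Fin 3) ℝ} {n : ℕ} (H : h.IsHomogeneous n) :
    theta h = Polynomial.monomial n h := by
  ext1 k
  rw [coeff_theta, Polynomial.coeff_monomial, homogeneousComponent_of_mem H]
  simp [eq_comm]

lemma hom_of_mul {r s g : MvPolynomial (Fin 3) ℝ} {n : ℕ} (hg : g.IsHomogeneous n) (g0 : g ≠ 0)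
    (e : g = r * s) : ∃ i j, i + j = n ∧ r.IsHomogeneous i ∧ s.IsHomogeneous j := by
  have h1 : theta r * theta s = Polynomial.monomial n g := by
    rw [← map_mul, ← e, theta_of_hom hg]
  have hm : Polynomial.monomial n g ≠ 0 := by simpa using g0
  have hr : theta r ≠ 0 := by rintro h; rw [h] at h1; simp only [zero_mul] at h1; exact hm h1.symm
  have hs : theta s ≠ 0 := by rintro h; rw [h] at h1; simp only [mul_zero] at h1; exact hm h1.symm
  have d1 := Polynomial.natDegree_mul hr hs
  have d2 := Polynomial.natTrailingDegree_mul hr hs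
  rw [h1, Polynomial.natDegree_monomial, if_neg g0] at d1
  rw [h1, Polynomial.natTrailingDegree_monomial g0] at d2
  have a1 := Polynomial.natTrailingDegree_le_natDegree (theta r)
  have a2 := Polynomial.natTrailingDegree_le_natDegree (theta s)
  refine ⟨(theta r).natDegree, (theta s).natDegree, d1.symm, isHomogeneous_of_theta ?_, isHomogeneous_of_theta ?_⟩
  all_goals
    intro k hk
    rw [← coeff_theta]
    rcases lt_or_gt_of_ne hk with h | h
    · exact Polynomial.coeff_eq_zero_of_lt_natTrailingDegree (by omega)
    · exact Polynomial.coeff_eq_zero_of_natDegree_lt h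

lemma sq_sum_poly (n : ℕ) : ∀ {m : ℕ} (H : Fin m → Polynomial ℝ) (c : ℝ),
    ∑ i, (H i) ^ 2 = Polynomial.C c * Polynomial.X ^ (2 * n) →
    ∀ i k, k ≠ n → (H i).coeff k = 0 := by
  induction n with
  | zero =>
    intro m H c e i k hk
    have : (H i).degree ≤ 0 := by
      rw [← Polynomial.isBoundedUnder_abs_atTop_iff]
      refine Filter.isBoundedUnder_of ⟨c + 1, fun x => ?_⟩
      have e2 := congrArg (Polynomial.eval x) e
      simp [Polynomial.eval_finsetSum] at e2
      have : (Polynomial.eval x (H i))^2 ≤ ∑ i, (Polynomial.eval x (H i))^2 :=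
        Finset.single_le_sum (f := fun i => (Polynomial.eval x (H i))^2) (fun j _ => sq_nonneg _) (Finset.mem_univ i)
      rw [← sq_abs] at this
      nlinarith [abs_nonneg (Polynomial.eval x (H i))]
    exact Polynomial.coeff_eq_zero_of_degree_lt (lt_of_le_of_lt this (by exact_mod_cast Nat.pos_of_ne_zero hk))
  | succ n ih =>
    intro m H c e
    have h0 : ∀ i, (H i).coeff 0 = 0 := by
      intro i
      have e2 := congrArg (Polynomial.eval 0) e
      simp [Polynomial.eval_finsetSum] at e2
      rw [Finset.sum_eq_zero_iff_of_nonneg (fun j _ => sq_nonneg _)] at e2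
      have := e2 i (Finset.mem_univ i)
      rw [Polynomial.coeff_zero_eq_eval_zero]
      simpa using this
    have h1 : ∀ i, ∃ K, H i = Polynomial.X * K := fun i => Polynomial.X_dvd_iff.2 (h0 i)
    choose K hK using h1
    have e3 : ∑ i, (K i) ^ 2 = Polynomial.C c * Polynomial.X ^ (2 * n) := by
      have hx : (Polynomial.X : Polynomial ℝ) ^ 2 ≠ 0 := pow_ne_zero _ Polynomial.X_ne_zero
      apply mul_left_cancel₀ hx
      rw [Finset.mul_sum]
      simp only [hK, mul_pow] at e
      rw [e]; ring
    intro i k hk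
    rw [hK]
    cases k with
    | zero => simp
    | succ k => rw [Polynomial.coeff_X_mul]; exact ih K c e3 i k (by omega)

lemma sos_hom {g : MvPolynomial (Fin 3) ℝ} (hg : g.IsHomogeneous 6) {n : ℕ}
    (h : Fin n → MvPolynomial (Fin 3) ℝ) (e : g = ∑ i, (h i) ^ 2) (i : Fin n) :
    (h i).IsHomogeneous 3 := by
  apply isHomogeneous_of_theta
  intro k hk
  apply MvPolynomial.funext
  intro u
  have := sq_sum_poly 3 (fun i => (theta (h i)).map (eval u)) (eval u g) (by
    have e2 := congrArg (fun p => (theta p).map (eval u)) e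
    simp only [theta_of_hom hg, map_sum, map_pow, Polynomial.map_sum, Polynomial.map_pow, Polynomial.map_monomial] at e2
    rw [← e2, Polynomial.C_mul_X_pow_eq_monomial]) i k hk
  rw [Polynomial.coeff_map, coeff_theta] at this
  simpa using this

lemma eval_smul {p : MvPolynomial (Fin 3) ℝ} {n : ℕ} (hp : p.IsHomogeneous n) (t : ℝ)
    (u : Fin 3 → ℝ) : eval (t • u) p = t ^ n * eval u p := by
  rw [eval_eq, eval_eq, Finset.mul_sum]
  apply Finset.sum_congr rfl
  intro d hd
  have : ∑ i, d i = n := by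
    have := hp (mem_support_iff.1 hd)
    rw [← Finsupp.degree_eq_sum, Finsupp.degree_eq_weight_one]; exact this
  have e : ∏ i ∈ d.support, (t • u) i ^ d i = ∏ i, (t • u) i ^ d i :=
    Finsupp.prod_fintype d (fun i k => (t • u) i ^ k) (by simp)
  have e' : ∏ i ∈ d.support, u i ^ d i = ∏ i, u i ^ d i :=
    Finsupp.prod_fintype d (fun i k => u i ^ k) (by simp)
  rw [e, e']
  simp only [Pi.smul_apply, smul_eq_mul, mul_pow, Finset.prod_mul_distrib, Finset.prod_pow_eq_pow_sum, this]
  ring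

lemma vanish_mk {p : MvPolynomial (Fin 3) ℝ} {n : ℕ} (hp : p.IsHomogeneous n)
    (z : Fin 3 → ℝ) (hz : z ≠ 0) (h : eval z p = 0) : VanishAt p (Projectivization.mk ℝ z hz) := by
  obtain ⟨a, ha⟩ := Projectivization.exists_smul_eq_mk_rep ℝ z hz
  unfold VanishAt
  rw [← ha, Units.smul_def, eval_smul hp, h, mul_zero]

lemma P2_infinite : Infinite P2 := by
  have hz : ∀ t : ℝ, (![1, t, 0] : Fin 3 → ℝ) ≠ 0 := by
    intro t h; have := congrFun h 0; simp at this
  refine Infinite.of_injective (fun t : ℝ => Projectivization.mk ℝ _ (hz t)) ?_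
  intro s t h
  simp only [Projectivization.mk_eq_mk_iff'] at h
  obtain ⟨a, ha⟩ := h
  have h0 := congrFun ha 0
  have h1 := congrFun ha 1
  simp at h0 h1
  rw [h0] at h1; simpa using h1.symm

lemma ne_zero_of_fin {p : MvPolynomial (Fin 3) ℝ} (hf : (VR p).Finite) : p ≠ 0 := by
  rintro rfl
  have : VR 0 = Set.univ := by ext; simp [VR, VanishAt]
  rw [this] at hf
  have := P2_infinite
  exact Set.infinite_univ hf

lemma span_two_ne_top (u v : Fin 3 → ℝ) : Submodule.span ℝ {u, v} ≠ ⊤ := by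
  intro h
  have h1 := finrank_span_finset_le_card (R := ℝ) ({u, v} : Finset (Fin 3 → ℝ))
  have h2 : ({u, v} : Finset (Fin 3 → ℝ)).card ≤ 2 := Finset.card_le_two
  rw [Set.finrank, Finset.coe_insert, Finset.coe_singleton, h, finrank_top] at h1
  simp only [Module.finrank_fintype_fun_eq_card, Fintype.card_fin] at h1
  omega

lemma sign_change {p : MvPolynomial (Fin 3) ℝ} {n : ℕ} (hp : p.IsHomogeneous n)
    (hf : (VR p).Finite) (u v : Fin 3 → ℝ) (hu : 0 < eval u p) (hv : eval v p < 0) : False := by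
  have hU : IsOpen {x : Fin 3 → ℝ | eval x p < 0} :=
    isOpen_lt (MvPolynomial.continuous_eval p) continuous_const
  have hop : ∀ y : Fin 3 → ℝ, IsOpen ((Submodule.span ℝ {u, y} : Set (Fin 3 → ℝ))ᶜ) := fun y =>
    (Submodule.closed_of_finiteDimensional _).isOpen_compl
  have hde : ∀ y : Fin 3 → ℝ, Dense ((Submodule.span ℝ {u, y} : Set (Fin 3 → ℝ))ᶜ) := by
    intro y
    rw [← interior_eq_empty_iff_dense_compl]
    by_contra h
    exact span_two_ne_top u y (Submodule.eq_top_of_nonempty_interior' _ (Set.nonempty_iff_ne_empty.2 h))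
  have hd : Dense (⋂ y ∈ insert u (Projectivization.rep '' VR p), ((Submodule.span ℝ {u, y} : Set (Fin 3 → ℝ))ᶜ)) :=
    dense_biInter_of_isOpen (fun y _ => hop y) ((hf.image _).insert u).countable (fun y _ => hde y)
  obtain ⟨w, hw1, hw2⟩ := hd.inter_open_nonempty _ hU ⟨v, hv⟩
  simp only [Set.mem_iInter, Set.mem_compl_iff, SetLike.mem_coe] at hw2
  have hc : ContinuousOn (fun t : ℝ => eval (u + t • (w - u)) p) (Set.Icc 0 1) := by
    apply Continuous.continuousOn
    exact (MvPolynomial.continuous_eval p).comp (by fun_prop)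
  have := intermediate_value_Icc' (zero_le_one) hc
  obtain ⟨t, ht, hz⟩ := this (show (0:ℝ) ∈ _ by
    refine ⟨?_, ?_⟩
    · simpa using le_of_lt hw1
    · simpa using hu.le)
  simp only at hz
  have ht0 : t ≠ 0 := by rintro rfl; simp at hz; exact hu.ne' hz
  have key : ∀ y, y ∈ insert u (Projectivization.rep '' VR p) →
      u + t • (w - u) ∉ Submodule.span ℝ {u, y} := by
    intro y hy hmem
    apply hw2 y hy
    have hu' : u ∈ Submodule.span ℝ {u, y} := Submodule.subset_span (by simp)
    have h1 : t⁻¹ • ((u + t • (w - u)) - u) + u ∈ Submodule.span ℝ {u, y} :=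
      Submodule.add_mem _ (Submodule.smul_mem _ _ (Submodule.sub_mem _ hmem hu')) hu'
    rwa [add_sub_cancel_left, smul_smul, inv_mul_cancel₀ ht0, one_smul, sub_add_cancel] at h1
  have hne : u + t • (w - u) ≠ 0 := by
    intro h
    apply key u (by simp)
    rw [h]; exact Submodule.zero_mem _
  obtain ⟨a, ha⟩ := Projectivization.exists_smul_eq_mk_rep ℝ _ hne
  apply key (Projectivization.mk ℝ _ hne).rep
  · right; exact ⟨_, vanish_mk hp _ hne hz, rfl⟩
  · have : u + t • (w - u) = (a⁻¹ : ℝˣ) • (Projectivization.mk ℝ _ hne).rep := by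
      rw [← ha, inv_smul_smul]
    have h2 : (a⁻¹ : ℝˣ) • (Projectivization.mk ℝ _ hne).rep ∈
        Submodule.span ℝ {u, (Projectivization.mk ℝ _ hne).rep} :=
      Submodule.smul_mem _ ((a⁻¹ : ℝˣ) : ℝ) (Submodule.subset_span (by simp))
    rwa [← this] at h2

lemma semidef {p : MvPolynomial (Fin 3) ℝ} {n : ℕ} (hp : p.IsHomogeneous n)
    (hf : (VR p).Finite) : Psd p ∨ Psd (-p) := by
  by_contra! h
  unfold Psd at h
  push Not at h
  obtain ⟨⟨v, hv⟩, u, hu⟩ := h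
  exact sign_change hp hf u v (by simpa using hu) hv

lemma odd_false {p : MvPolynomial (Fin 3) ℝ} {n : ℕ} (hp : p.IsHomogeneous n)
    (hf : (VR p).Finite) (hn : Odd n) : False := by
  have p0 := ne_zero_of_fin hf
  apply p0
  apply MvPolynomial.funext
  intro u
  have hneg : eval ((-1 : ℝ) • u) p = - eval u p := by
    rw [eval_smul hp, hn.neg_one_pow]; ring
  rw [map_zero]
  by_contra h
  rcases lt_or_gt_of_ne h with h | h
  · exact sign_change hp hf ((-1 : ℝ) • u) u (by linarith) h
  · exact sign_change hp hf u ((-1 : ℝ) • u) h (by linarith)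

/-- The linear form with coefficient vector `c`. -/
def lin (c : Fin 3 → ℝ) : MvPolynomial (Fin 3) ℝ := ∑ j, C (c j) * X j

lemma lin_hom (c : Fin 3 → ℝ) : (lin c).IsHomogeneous 1 :=
  IsHomogeneous.sum _ _ _ (fun _ _ => isHomogeneous_C_mul_X _ _)

lemma eval_lin (c u : Fin 3 → ℝ) : eval u (lin c) = c ⬝ᵥ u := by
  simp [lin, dotProduct]

lemma quad_sos {p : MvPolynomial (Fin 3) ℝ} (hp : p.IsHomogeneous 2) (h : Psd p) :
    ∃ (n : ℕ) (B : Fin n → Fin 3 → ℝ), p = ∑ k, (lin (B k)) ^ 2 := by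
  have hc : ∀ i j, ∃ m : ℝ, pderiv j (pderiv i p) = C m := by
    intro i j
    have := (hp.pderiv (i := i)).pderiv (i := j)
    rw [← totalDegree_zero_iff_isHomogeneous, totalDegree_eq_zero_iff_eq_C] at this
    exact ⟨_, this⟩
  choose m hm using hc
  have h1 : ∀ i, pderiv i p = ∑ j, X j * C (m i j) := by
    intro i
    have := (hp.pderiv (i := i)).sum_X_mul_pderiv
    simpa [hm] using this.symm
  have h2 : (2 : ℕ) • p = ∑ i, X i * ∑ j, X j * C (m i j) := by
    rw [← hp.sum_X_mul_pderiv]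
    exact Finset.sum_congr rfl (fun i _ => by rw [h1])
  have hsym : ∀ i j, m i j = m j i := by
    intro i j
    have e1 := hm i j
    rw [h1] at e1
    have e2 := hm j i
    have h3 := congrArg (fun q => pderiv j (pderiv i q)) h2
    have h4 := congrArg (fun q => pderiv i (pderiv j q)) h2
    have e3 : pderiv j (pderiv i p) = pderiv i (pderiv j p) := by
      ext d
      simp only [coeff_pderiv]
      by_cases hij : i = j
      · subst hij; rfl
      · simp [hij, Ne.symm hij, add_right_comm]
        ring
    rw [hm, hm] at e3
    exact C_injective _ _ e3
  have hev : ∀ u : Fin 3 → ℝ, 2 * eval u p = ∑ i, u i * ∑ j, u j * m i j := by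
    intro u
    have := congrArg (eval u) h2
    simpa using this
  have hpsd : (Matrix.of m).PosSemidef := by
    refine Matrix.PosSemidef.of_dotProduct_mulVec_nonneg ?_ ?_
    · ext i j; simp [hsym j i]
    · intro u
      have := hev u
      have e : star u ⬝ᵥ (Matrix.of m).mulVec u = 2 * eval u p := by
        rw [this]; simp [dotProduct, Matrix.mulVec, mul_comm]
      rw [e]; linarith [h u]
  obtain ⟨n, B, hB⟩ := Matrix.posSemidef_iff_eq_sum_vecMulVec.1 hpsd
  refine ⟨n, fun k j => B k j / Real.sqrt 2, ?_⟩
  apply MvPolynomial.funext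
  intro u
  have h5 : 2 * eval u p = ∑ k, (B k ⬝ᵥ u)^2 := by
    rw [hev u]
    have : ∀ i j, m i j = ∑ k, B k i * B k j := by
      intro i j
      have := congrFun (congrFun hB i) j
      simpa [Matrix.sum_apply, Matrix.vecMulVec_apply] using this
    have h7 : ∀ k, (B k ⬝ᵥ u)^2 = ∑ i, u i * ∑ j, u j * (B k i * B k j) := by
      intro k
      simp only [dotProduct, Fin.sum_univ_three]; ring
    simp only [h7, this, Fin.sum_univ_three, Finset.mul_sum, Finset.sum_add_distrib, mul_add]
  have h6 : ∀ k, ((fun j => B k j / Real.sqrt 2) ⬝ᵥ u)^2 = (B k ⬝ᵥ u)^2 / 2 := by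
    intro k
    have : (fun j => B k j / Real.sqrt 2) ⬝ᵥ u = (B k ⬝ᵥ u) / Real.sqrt 2 := by
      simp only [dotProduct, Fin.sum_univ_three]; ring
    rw [this, div_pow, Real.sq_sqrt (by norm_num)]
  simp only [map_sum, map_pow, eval_lin, h6]
  rw [← Finset.sum_div, ← h5]; ring

lemma quad_line {p : MvPolynomial (Fin 3) ℝ} (hp : p.IsHomogeneous 2) (h : Psd p) (p0 : p ≠ 0) :
    ∃ c, lin c ≠ 0 ∧ ∀ u, eval u p = 0 → eval u (lin c) = 0 := by
  obtain ⟨n, B, hB⟩ := quad_sos hp h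
  have : ∃ k, lin (B k) ≠ 0 := by
    by_contra! hk
    apply p0; rw [hB]; simp [hk]
  obtain ⟨k, hk⟩ := this
  refine ⟨B k, hk, fun u hu => ?_⟩
  rw [hB] at hu
  simp only [map_sum, map_pow] at hu
  rw [Finset.sum_eq_zero_iff_of_nonneg (fun j _ => sq_nonneg _)] at hu
  simpa using hu k (Finset.mem_univ k)

lemma Sos.mapA {p : MvPolynomial (Fin 3) ℝ} (h : Sos p)
    (f : MvPolynomial (Fin 3) ℝ →ₐ[ℝ] MvPolynomial (Fin 3) ℝ) : Sos (f p) := by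
  obtain ⟨n, h, rfl⟩ := h
  exact ⟨n, fun i => f (h i), by simp⟩

lemma Sos.mul' {p q : MvPolynomial (Fin 3) ℝ} (hp : Sos p) (hq : Sos q) : Sos (p * q) := by
  obtain ⟨n, h, rfl⟩ := hp
  obtain ⟨m, k, rfl⟩ := hq
  refine ⟨n * m, fun x => h (finProdFinEquiv.symm x).1 * k (finProdFinEquiv.symm x).2, ?_⟩
  rw [Equiv.sum_comp finProdFinEquiv.symm (fun x => (h x.1 * k x.2) ^ 2), Finset.sum_mul_sum,
    Fintype.sum_prod_type]
  simp [mul_pow]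

/-- Linear substitution by a matrix. -/
def subst (A : Matrix (Fin 3) (Fin 3) ℝ) : MvPolynomial (Fin 3) ℝ →ₐ[ℝ] MvPolynomial (Fin 3) ℝ :=
  aeval (fun i => lin (A i))

lemma eval_subst (A : Matrix (Fin 3) (Fin 3) ℝ) (p : MvPolynomial (Fin 3) ℝ) (u : Fin 3 → ℝ) :
    eval u (subst A p) = eval (A.mulVec u) p := by
  induction p using MvPolynomial.induction_on with
  | C a => simp [subst]
  | add p q hp hq => simp [hp, hq]
  | mul_X p i hp =>
    rw [map_mul, map_mul, map_mul, hp]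
    simp [subst, eval_lin, Matrix.mulVec]

lemma subst_hom (A : Matrix (Fin 3) (Fin 3) ℝ) {p : MvPolynomial (Fin 3) ℝ} {n : ℕ}
    (hp : p.IsHomogeneous n) : (subst A p).IsHomogeneous n := by
  have := hp.aeval (fun i => lin (A i)) (fun i => lin_hom (A i))
  rw [one_mul] at this
  exact this

lemma hasDeriv (p : MvPolynomial (Fin 3) ℝ) (v : Fin 3 → ℝ) (j : Fin 3) :
    HasDerivAt (fun t : ℝ => eval (v + t • Pi.single j (1 : ℝ)) p) (eval v (pderiv j p)) 0 := by
  induction p using MvPolynomial.induction_on with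
  | C a => simpa using hasDerivAt_const (0 : ℝ) a
  | add p q hp hq => simp only [map_add]; exact HasDerivAt.add hp hq
  | mul_X p i hp =>
    have hx : HasDerivAt (fun t : ℝ => v i + t * (Pi.single j (1:ℝ) : Fin 3 → ℝ) i)
        ((Pi.single j (1:ℝ) : Fin 3 → ℝ) i) 0 := by
      have := ((hasDerivAt_id (0:ℝ)).mul_const ((Pi.single j (1:ℝ) : Fin 3 → ℝ) i)).const_add (v i)
      rw [one_mul] at this
      exact this
    have h2 := HasDerivAt.mul hp hx
    simp only [map_mul, eval_X]
    refine (h2.congr_deriv ?_)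
    rw [Derivation.leibniz, pderiv_X]
    by_cases hij : i = j
    · subst hij; simp; ring
    · simp [hij]; ring

lemma psd_sing {p : MvPolynomial (Fin 3) ℝ} (h : Psd p) (v : Fin 3 → ℝ) (hv : eval v p = 0)
    (j : Fin 3) : eval v (pderiv j p) = 0 := by
  refine IsLocalMin.hasDerivAt_eq_zero ?_ (hasDeriv p v j)
  refine Filter.Eventually.of_forall (fun t => ?_)
  simpa [hv] using h _

lemma eval_single {p : MvPolynomial (Fin 3) ℝ} {n : ℕ} (hp : p.IsHomogeneous n) (i : Fin 3) :
    eval (Pi.single i (1 : ℝ)) p = coeff (Finsupp.single i n) p := by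
  rw [eval_eq']
  by_cases hn : Finsupp.single i n ∈ p.support
  · rw [Finset.sum_eq_single_of_mem _ hn]
    · rw [Finset.prod_eq_one, mul_one]
      intro k _
      by_cases hk : k = i <;> simp [hk]
    · intro d hd hne
      have hdeg : ∑ i, d i = n := by
        rw [← Finsupp.degree_eq_sum, Finsupp.degree_eq_weight_one]; exact hp (mem_support_iff.1 hd)
      have : ∃ k, k ≠ i ∧ d k ≠ 0 := by
        by_contra! hk
        apply hne
        have hs := Finset.sum_eq_single (s := Finset.univ) (f := d) i (fun k _ h => hk k h) (by simp)
        ext k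
        by_cases hki : k = i
        · subst hki; simp; omega
        · rw [hk k hki, Finsupp.single_eq_of_ne hki]
      obtain ⟨k, hk, hdk⟩ := this
      rw [Finset.prod_eq_zero (Finset.mem_univ k), mul_zero]
      simp [hk, hdk]
  · rw [notMem_support_iff.1 hn]
    apply Finset.sum_eq_zero
    intro d hd
    have hdeg : ∑ i, d i = n := by
      rw [← Finsupp.degree_eq_sum, Finsupp.degree_eq_weight_one]; exact hp (mem_support_iff.1 hd)
    have : ∃ k, k ≠ i ∧ d k ≠ 0 := by
      by_contra! hk
      apply hn
      have hs := Finset.sum_eq_single (s := Finset.univ) (f := d) i (fun k _ h => hk k h) (by simp)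
      have : Finsupp.single i n = d := by
        ext k
        by_cases hki : k = i
        · subst hki; simp; omega
        · rw [hk k hki, Finsupp.single_eq_of_ne hki]
      rwa [this]
    obtain ⟨k, hk, hdk⟩ := this
    rw [Finset.prod_eq_zero (Finset.mem_univ k), mul_zero]
    simp [hk, hdk]

lemma exp_le_two {q : MvPolynomial (Fin 3) ℝ} (hq : q.IsHomogeneous 4) (h : Psd q)
    (i : Fin 3) (hz : eval (Pi.single i (1 : ℝ)) q = 0) (d : Fin 3 →₀ ℕ) (hd : d ∈ q.support) :
    d i ≤ 2 := by
  have hdeg : d 0 + d 1 + d 2 = 4 := by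
    rw [← Fin.sum_univ_three, ← Finsupp.degree_eq_sum, Finsupp.degree_eq_weight_one]
    exact hq (mem_support_iff.1 hd)
  by_contra! hlt
  have hc : ∀ j, coeff (Finsupp.single i 3 + Finsupp.single j 1) q = 0 := by
    intro j
    have h1 := psd_sing h _ hz j
    rw [eval_single hq.pderiv i, coeff_pderiv] at h1
    rcases mul_eq_zero.1 h1 with h1 | h1
    · exact h1
    · exfalso; norm_cast at h1
  have : ∃ j, d = Finsupp.single i 3 + Finsupp.single j 1 := by
    have h3 : ∃ j, d j = (Finsupp.single i 3 : Fin 3 →₀ ℕ) j + 1 := by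
      by_contra! hh
      have a0 := hh 0
      have a1 := hh 1
      have a2 := hh 2
      fin_cases i <;> simp at * <;> omega
    obtain ⟨j, hj⟩ := h3
    refine ⟨j, ?_⟩
    ext k
    fin_cases i <;> fin_cases j <;> fin_cases k <;> simp at * <;> omega
  obtain ⟨j, hj⟩ := this
  rw [mem_support_iff, hj] at hd
  exact hd (hc j)

lemma quartic_sos_coord {q : MvPolynomial (Fin 3) ℝ} (hq : q.IsHomogeneous 4) (h : Psd q)
    (hz : ∀ i, eval (Pi.single i (1 : ℝ)) q = 0) : Sos q := by
  let w : (Fin 3 →₀ ℕ) → (Fin 3 →₀ ℕ) := fun d => Finsupp.equivFunOnFinite.symm (fun i => 2 - d i)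
  let Q : MvPolynomial (Fin 3) ℝ := ∑ d ∈ q.support, monomial (w d) (coeff d q)
  let f : MvPolynomial (Fin 3) ℝ →ₐ[ℝ] MvPolynomial (Fin 3) ℝ :=
    aeval ![X 1 * X 2, X 0 * X 2, X 0 * X 1]
  have hdeg : ∀ d ∈ q.support, d 0 + d 1 + d 2 = 4 := by
    intro d hd
    rw [← Fin.sum_univ_three, ← Finsupp.degree_eq_sum, Finsupp.degree_eq_weight_one]
    exact hq (mem_support_iff.1 hd)
  have hle := fun i => exp_le_two hq h i (hz i)
  have hQ : Q.IsHomogeneous 2 := by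
    apply IsHomogeneous.sum
    intro d hd
    apply isHomogeneous_monomial
    rw [Finsupp.degree_eq_sum, Fin.sum_univ_three]
    have := hdeg d hd
    have a0 := hle 0 d hd
    have a1 := hle 1 d hd
    have a2 := hle 2 d hd
    simp [w]
    omega
  have hf : f Q = q := by
    conv_rhs => rw [q.as_sum]
    rw [map_sum]
    apply Finset.sum_congr rfl
    intro d hd
    have := hdeg d hd
    have a0 := hle 0 d hd
    have a1 := hle 1 d hd
    have a2 := hle 2 d hd
    simp only [f]
    rw [aeval_monomial, monomial_eq, Finsupp.prod_fintype _ _ (by simp),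
      Finsupp.prod_fintype _ _ (by simp)]
    simp only [Fin.prod_univ_three, w, Finsupp.equivFunOnFinite_symm_apply_apply, Matrix.cons_val_zero,
      Matrix.cons_val_one, Matrix.cons_val, algebraMap_eq]
    congr 1
    have e0 : d 0 = (2 - d 1) + (2 - d 2) := by omega
    have e1 : d 1 = (2 - d 0) + (2 - d 2) := by omega
    have e2 : d 2 = (2 - d 0) + (2 - d 1) := by omega
    generalize 2 - d 0 = x0 at *
    generalize 2 - d 1 = x1 at *
    generalize 2 - d 2 = x2 at *
    rw [e0, e1, e2]
    simp only [mul_pow, pow_add]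
    ring
  have hev : ∀ u : Fin 3 → ℝ, eval u (f Q) = eval ![u 1 * u 2, u 0 * u 2, u 0 * u 1] Q := by
    intro u
    have : (eval u).comp (f : MvPolynomial (Fin 3) ℝ →+* MvPolynomial (Fin 3) ℝ) =
        eval ![u 1 * u 2, u 0 * u 2, u 0 * u 1] := by
      apply MvPolynomial.ringHom_ext
      · intro r; simp [f]
      · intro i; fin_cases i <;> simp [f]
    exact RingHom.congr_fun this Q
  have hpos : ∀ u : Fin 3 → ℝ, (∀ i, u i ≠ 0) → 0 ≤ eval u Q := by
    intro u hu
    have h1 := h ![u 1 * u 2, u 0 * u 2, u 0 * u 1]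
    rw [← hf, hev] at h1
    have e : (![(![u 1 * u 2, u 0 * u 2, u 0 * u 1] : Fin 3 → ℝ) 1 * (![u 1 * u 2, u 0 * u 2, u 0 * u 1] : Fin 3 → ℝ) 2,
      (![u 1 * u 2, u 0 * u 2, u 0 * u 1] : Fin 3 → ℝ) 0 * (![u 1 * u 2, u 0 * u 2, u 0 * u 1] : Fin 3 → ℝ) 2,
      (![u 1 * u 2, u 0 * u 2, u 0 * u 1] : Fin 3 → ℝ) 0 * (![u 1 * u 2, u 0 * u 2, u 0 * u 1] : Fin 3 → ℝ) 1] : Fin 3 → ℝ)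
       = (u 0 * u 1 * u 2) • u := by
      ext i
      fin_cases i <;> simp <;> ring
    rw [e, eval_smul hQ] at h1
    have : 0 < (u 0 * u 1 * u 2) ^ 2 := by
      have := mul_ne_zero (mul_ne_zero (hu 0) (hu 1)) (hu 2)
      positivity
    exact nonneg_of_mul_nonneg_right h1 this
  have hQpsd : Psd Q := by
    intro u
    have hcl : IsClosed {x : Fin 3 → ℝ | 0 ≤ eval x Q} :=
      isClosed_le continuous_const (MvPolynomial.continuous_eval Q)
    have hd : Dense (Set.pi Set.univ (fun _ : Fin 3 => ({0}ᶜ : Set ℝ))) :=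
      dense_pi _ (fun i _ => dense_compl_singleton 0)
    have : closure (Set.pi Set.univ (fun _ : Fin 3 => ({0}ᶜ : Set ℝ))) ⊆ {x : Fin 3 → ℝ | 0 ≤ eval x Q} := by
      apply closure_minimal _ hcl
      intro x hx
      exact hpos x (fun i => by simpa using hx i (Set.mem_univ i))
    rw [hd.closure_eq] at this
    exact this (Set.mem_univ u)
  obtain ⟨n, B, hB⟩ := quad_sos hQ hQpsd
  rw [← hf]
  exact Sos.mapA ⟨n, _, hB⟩ f

lemma quartic_cases {q : MvPolynomial (Fin 3) ℝ} (hq : q.IsHomogeneous 4) (h : Psd q) :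
    Sos q ∨ ∃ c, lin c ≠ 0 ∧ ∀ u, eval u q = 0 → eval u (lin c) = 0 := by
  let Z : Set (Fin 3 → ℝ) := {u | eval u q = 0}
  by_cases hZ : Submodule.span ℝ Z = ⊤
  · left
    obtain ⟨b, hbZ, hspan, hli⟩ := exists_linearIndependent ℝ Z
    rw [hZ] at hspan
    let bas := Module.Basis.mk hli (by rw [Subtype.range_coe]; exact hspan.ge)
    have hfb : Finite b := Module.Finite.finite_basis bas
    have := Fintype.ofFinite b
    have hcard : Fintype.card b = 3 := by
      rw [← Module.finrank_eq_card_basis bas]; simp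
    let e : Fin 3 ≃ b := (Fintype.equivFinOfCardEq hcard).symm
    let A : Matrix (Fin 3) (Fin 3) ℝ := Matrix.transpose (Matrix.of (fun i => (e i : Fin 3 → ℝ)))
    have hA : IsUnit A := by
      rw [Matrix.isUnit_transpose, ← Matrix.linearIndependent_rows_iff_isUnit]
      exact hli.comp e e.injective
    have hinv : A * A⁻¹ = 1 := Matrix.mul_nonsing_inv _ ((Matrix.isUnit_iff_isUnit_det _).1 hA)
    have hback : subst A⁻¹ (subst A q) = q := by
      apply MvPolynomial.funext
      intro u
      rw [eval_subst, eval_subst, Matrix.mulVec_mulVec, hinv, Matrix.one_mulVec]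
    rw [← hback]
    refine Sos.mapA (quartic_sos_coord (subst_hom A hq) ?_ ?_) _
    · intro u; rw [eval_subst]; exact h _
    · intro i
      rw [eval_subst, Matrix.mulVec_single_one]
      exact hbZ (e i).2
  · right
    obtain ⟨f, f0, hf⟩ := Submodule.exists_le_ker_of_lt_top _ (lt_top_iff_ne_top.2 hZ)
    have hfe : ∀ u, f u = eval u (lin (fun i => f (Pi.single i 1))) := by
      intro u
      rw [eval_lin]
      conv_lhs => rw [LinearMap.pi_apply_eq_sum_univ f u]
      have : ∀ i : Fin 3, (fun j => if i = j then (1 : ℝ) else 0) = Pi.single i 1 := by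
        intro i; ext j; simp [Pi.single_apply, eq_comm]
      simp only [this, dotProduct, smul_eq_mul, mul_comm]
    refine ⟨fun i => f (Pi.single i 1), ?_, ?_⟩
    · intro h0
      apply f0
      apply LinearMap.ext
      intro u
      rw [hfe, h0]; simp
    · intro u hu
      rw [← hfe]
      exact hf (Submodule.subset_span hu)

lemma VR_mono {p q g : MvPolynomial (Fin 3) ℝ} (e : g = p * q) : VR p ⊆ VR g := by
  intro P hP
  have : eval P.rep p = 0 := hP
  show eval P.rep g = 0
  rw [e, map_mul, this, zero_mul]

lemma not_sos {g : MvPolynomial (Fin 3) ℝ} (hg6 : g.IsHomogeneous 6)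
    (hfin : (VR g).Finite) (S : Set P2) (hSsub : S ⊆ VR g)
    (hdim : Module.finrank ℝ (Isub 3 S) = 1) : ¬ Sos g := by
  rintro ⟨n, h, e⟩
  have hhom := sos_hom hg6 h e
  obtain ⟨f, f0, hf⟩ := finrank_eq_one_iff'.1 hdim
  have hmem : ∀ i, h i ∈ Isub 3 S := by
    intro i
    refine ⟨hhom i, ?_⟩
    intro P hP
    have h1 : eval P.rep g = 0 := hSsub hP
    rw [e] at h1
    simp only [map_sum, map_pow] at h1
    rw [Finset.sum_eq_zero_iff_of_nonneg (fun j _ => sq_nonneg _)] at h1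
    show eval P.rep (h i) = 0
    simpa using h1 i (Finset.mem_univ i)
  have hc : ∀ i, ∃ c : ℝ, h i = C c * f.1 := by
    intro i
    obtain ⟨c, hc⟩ := hf ⟨h i, hmem i⟩
    refine ⟨c, ?_⟩
    have := congrArg Subtype.val hc
    simp only [Submodule.coe_smul] at this
    rw [← this, smul_eq_C_mul]
  choose c hc using hc
  have e2 : g = f.1 * (∑ i, C (c i) ^ 2 * f.1) := by
    rw [e, Finset.mul_sum]
    exact Finset.sum_congr rfl (fun i _ => by rw [hc]; ring)
  exact odd_false (n := 3) f.2.1 (hfin.subset (VR_mono e2)) (by decide)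

lemma two_four_false {g p q : MvPolynomial (Fin 3) ℝ} (hg6 : g.IsHomogeneous 6) (hpsd : Psd g)
    (hfin : (VR g).Finite) (S : Set P2) (hSsub : S ⊆ VR g)
    (hdim : Module.finrank ℝ (Isub 3 S) = 1) (e : g = p * q)
    (hp : p.IsHomogeneous 2) (hq : q.IsHomogeneous 4) : False := by
  have g0 := ne_zero_of_fin hfin
  have p0 : p ≠ 0 := by rintro rfl; apply g0; rw [e, zero_mul]
  -- reduce to the case where `p` is psd
  have main : ∀ p q : MvPolynomial (Fin 3) ℝ, g = p * q → p ≠ 0 → p.IsHomogeneous 2 →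
      q.IsHomogeneous 4 → Psd p → False := by
    intro p q e p0 hp hq hpp
    have hqq : Psd q := by
      rcases semidef hq (hfin.subset (VR_mono (e.trans (mul_comm _ _)))) with h | h
      · exact h
      · exfalso
        apply g0
        apply MvPolynomial.funext
        intro u
        have h1 := hpsd u
        have h2 := hpp u
        have h3 := h u
        rw [map_neg] at h3
        have h4 : eval u g = eval u p * eval u q := by rw [e, map_mul]
        rw [map_zero]
        nlinarith [mul_nonneg h2 h3]
    obtain ⟨l, hl, hlz⟩ := quad_line hp hpp p0
    rcases quartic_cases hq hqq with hs | ⟨m, hm, hmz⟩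
    · apply not_sos hg6 hfin S hSsub hdim
      rw [e]
      obtain ⟨n, B, hB⟩ := quad_sos hp hpp
      exact Sos.mul' ⟨n, _, hB⟩ hs
    · have hmem : ∀ i : Fin 3, lin l * lin m * X i ∈ Isub 3 S := by
        intro i
        refine ⟨((lin_hom l).mul (lin_hom m)).mul (isHomogeneous_X _ i), ?_⟩
        intro P hP
        have h1 : eval P.rep g = 0 := hSsub hP
        show eval P.rep _ = 0
        rw [e, map_mul] at h1
        rw [map_mul, map_mul]
        rcases mul_eq_zero.1 h1 with h1 | h1
        · rw [hlz _ h1]; ring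
        · rw [hmz _ h1]; ring
      obtain ⟨f, f0, hf⟩ := finrank_eq_one_iff'.1 hdim
      obtain ⟨a, ha⟩ := hf ⟨_, hmem 0⟩
      obtain ⟨b, hb⟩ := hf ⟨_, hmem 1⟩
      have ha' : a • f.1 = lin l * lin m * X 0 := congrArg Subtype.val ha
      have hb' : b • f.1 = lin l * lin m * X 1 := congrArg Subtype.val hb
      have hk : (lin l * lin m) * (C b * X 0 - C a * X 1) = 0 := by
        have : (lin l * lin m) * (C b * X 0 - C a * X 1)
          = C b * (lin l * lin m * X 0) - C a * (lin l * lin m * X 1) := by ring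
        rw [this, ← ha', ← hb', smul_eq_C_mul, smul_eq_C_mul]; ring
      have hk2 := (mul_eq_zero.1 hk).resolve_left (mul_ne_zero hl hm)
      have hb0 : b = 0 := by
        have := congrArg (eval (Pi.single 0 1)) hk2
        simpa using this
      rw [hb0, zero_smul] at hb'
      exact mul_ne_zero (mul_ne_zero hl hm) (X_ne_zero 1) hb'.symm
  rcases semidef hp (hfin.subset (VR_mono e)) with h | h
  · exact main p q e p0 hp hq h
  · exact main (-p) (-q) (by rw [e]; ring) (neg_ne_zero.2 p0) hp.neg hq.neg h

lemma isUnit_of_hom_zero {p : MvPolynomial (Fin 3) ℝ} (hp : p.IsHomogeneous 0) (p0 : p ≠ 0) :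
    ∃ c : ℝ, c ≠ 0 ∧ p = C c := by
  rw [← totalDegree_zero_iff_isHomogeneous, totalDegree_eq_zero_iff_eq_C] at hp
  refine ⟨_, ?_, hp⟩
  intro h
  rw [h, map_zero] at hp
  exact p0 hp

/-- Real factorizations are trivial. -/
lemma real_factor {g p q : MvPolynomial (Fin 3) ℝ} (hg6 : g.IsHomogeneous 6) (hpsd : Psd g)
    (hfin : (VR g).Finite) (S : Set P2) (hSsub : S ⊆ VR g)
    (hdim : Module.finrank ℝ (Isub 3 S) = 1) (e : g = p * q) :
    (∃ c : ℝ, c ≠ 0 ∧ p = C c) ∨ (∃ c : ℝ, c ≠ 0 ∧ q = C c) := by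
  have g0 := ne_zero_of_fin hfin
  have p0 : p ≠ 0 := by rintro rfl; apply g0; rw [e, zero_mul]
  have q0 : q ≠ 0 := by rintro rfl; apply g0; rw [e, mul_zero]
  obtain ⟨i, j, hij, hp, hq⟩ := hom_of_mul hg6 g0 e
  have hpf := hfin.subset (VR_mono e)
  have e' := e.trans (mul_comm _ _)
  have hodd : ¬ Odd i := fun h => odd_false hp hpf h
  have : i ≤ 6 := by omega
  interval_cases i
  · left; exact isUnit_of_hom_zero hp p0
  · exact absurd (by decide) hodd
  · obtain rfl : j = 4 := by omega
    exact (two_four_false hg6 hpsd hfin S hSsub hdim e hp hq).elim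
  · exact absurd (by decide) hodd
  · obtain rfl : j = 2 := by omega
    exact (two_four_false hg6 hpsd hfin S hSsub hdim e' hq hp).elim
  · exact absurd (by decide) hodd
  · obtain rfl : j = 0 := by omega
    right; exact isUnit_of_hom_zero hq q0

/-- Complexification. -/
abbrev cx (p : MvPolynomial (Fin 3) ℝ) : MvPolynomial (Fin 3) ℂ := MvPolynomial.map (algebraMap ℝ ℂ) p

/-- Coefficientwise conjugation. -/
abbrev cj (p : MvPolynomial (Fin 3) ℂ) : MvPolynomial (Fin 3) ℂ := MvPolynomial.map (starRingEnd ℂ) p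

lemma cj_cj (p : MvPolynomial (Fin 3) ℂ) : cj (cj p) = p := by
  ext d; simp [coeff_map]

lemma cj_cx (p : MvPolynomial (Fin 3) ℝ) : cj (cx p) = cx p := by
  ext d; simp [coeff_map]

lemma cx_inj : Function.Injective cx := map_injective _ (algebraMap ℝ ℂ).injective

lemma re_im (a : MvPolynomial (Fin 3) ℂ) : ∃ r s, a = cx r + C Complex.I * cx s := by
  induction a using MvPolynomial.induction_on with
  | C z =>
    refine ⟨C z.re, C z.im, ?_⟩
    simp only [cx, map_C]
    rw [← C_mul, ← C_add]
    congr 1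
    simp [mul_comm Complex.I]
  | add p q hp hq =>
    obtain ⟨r, s, rfl⟩ := hp
    obtain ⟨r', s', rfl⟩ := hq
    exact ⟨r + r', s + s', by simp only [cx, map_add]; ring⟩
  | mul_X p i hp =>
    obtain ⟨r, s, rfl⟩ := hp
    exact ⟨r * X i, s * X i, by simp only [cx, map_mul, map_X]; ring⟩

lemma re_im_unique {r s r' s' : MvPolynomial (Fin 3) ℝ}
    (h : cx r + C Complex.I * cx s = cx r' + C Complex.I * cx s') : r = r' ∧ s = s' := by
  constructor
  all_goals
    ext d
    have := congrArg (coeff d) h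
    simp only [coeff_add, coeff_C_mul, coeff_map, cx] at this
    have h1 := congrArg Complex.re this
    have h2 := congrArg Complex.im this
    simp at h1 h2
    assumption

lemma cx_dvd {r g : MvPolynomial (Fin 3) ℝ} (h : cx r ∣ cx g) : r ∣ g := by
  obtain ⟨b, hb⟩ := h
  obtain ⟨s, t, rfl⟩ := re_im b
  have : cx g + C Complex.I * cx 0 = cx (r * s) + C Complex.I * cx (r * t) := by
    simp only [cx, map_mul, map_zero] at hb ⊢
    rw [hb]; ring
  exact ⟨s, (re_im_unique this).1⟩

lemma irred {g : MvPolynomial (Fin 3) ℝ} (hg6 : g.IsHomogeneous 6) (hpsd : Psd g)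
    (hfin : (VR g).Finite) (S : Set P2) (hSsub : S ⊆ VR g)
    (hdim : Module.finrank ℝ (Isub 3 S) = 1) : Irreducible (cx g) := by
  have g0 := ne_zero_of_fin hfin
  have hcx : ∀ c : ℝ, c ≠ 0 → IsUnit (cx (C c)) := by
    intro c hc
    exact (((isUnit_iff_ne_zero.2 hc).map C).map (MvPolynomial.map (algebraMap ℝ ℂ)))
  have hG0 : cx g ≠ 0 := by
    intro h; apply g0; apply cx_inj; rw [h]; simp [cx]
  have hGu : ¬ IsUnit (cx g) := by
    intro h
    obtain ⟨z, hz, hz2⟩ := MvPolynomial.isUnit_iff_eq_C_of_isReduced.1 h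
    have h6 : (cx g).IsHomogeneous 6 := hg6.map _
    rw [hz2] at h6 hG0
    have := h6.inj_right (isHomogeneous_C (Fin 3) z) hG0
    omega
  obtain ⟨a, ha, hag⟩ := WfDvdMonoid.exists_irreducible_factor hGu hG0
  have hcjmul : ∀ x y, cj (x * y) = cj x * cj y := fun x y => map_mul _ _ _
  have hconj : Irreducible (cj a) := by
    let E : MvPolynomial (Fin 3) ℂ ≃+* MvPolynomial (Fin 3) ℂ :=
      RingEquiv.ofRingHom (MvPolynomial.map (starRingEnd ℂ)) (MvPolynomial.map (starRingEnd ℂ))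
        (RingHom.ext cj_cj) (RingHom.ext cj_cj)
    exact (MulEquiv.irreducible_iff E).2 ha
  have hagc : cj a ∣ cx g := by
    obtain ⟨b, hb⟩ := hag
    refine ⟨cj b, ?_⟩
    rw [← hcjmul, ← hb, cj_cx]
  -- a real divisor associated to `a` finishes the proof
  have fin1 : ∀ r : MvPolynomial (Fin 3) ℝ, Associated a (cx r) → Irreducible (cx g) := by
    intro r hr
    have hirr : Irreducible (cx r) := hr.irreducible_iff.1 ha
    obtain ⟨s, hs⟩ := cx_dvd (hr.dvd_iff_dvd_left.1 hag)
    rcases real_factor hg6 hpsd hfin S hSsub hdim hs with ⟨c, hc, rfl⟩ | ⟨c, hc, rfl⟩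
    · exact (hirr.not_isUnit (hcx c hc)).elim
    · have : cx g = cx r * cx (C c) := by rw [hs]; simp only [cx, map_mul]
      rw [this, irreducible_mul_isUnit (hcx c hc)]
      exact hirr
  obtain ⟨r, s, hrs⟩ := re_im a
  have hcja : cj a = cx r - C Complex.I * cx s := by
    rw [hrs]
    simp only [cj, map_add, map_mul, map_C, Complex.conj_I]
    rw [show MvPolynomial.map (starRingEnd ℂ) (cx r) = cx r from cj_cx r,
      show MvPolynomial.map (starRingEnd ℂ) (cx s) = cx s from cj_cx s]
    simp only [map_neg]; ring
  have hII : (C Complex.I * C Complex.I : MvPolynomial (Fin 3) ℂ) = -1 := by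
    rw [← C_mul, Complex.I_mul_I]; simp
  have hCu : ∀ z : ℂ, z ≠ 0 → IsUnit (C z : MvPolynomial (Fin 3) ℂ) := fun z hz =>
    (isUnit_iff_ne_zero.2 hz).map C
  by_cases hass : Associated a (cj a)
  · obtain ⟨u, hu⟩ := hass
    obtain ⟨z, hz, hz2⟩ := MvPolynomial.isUnit_iff_eq_C_of_isReduced.1 u.isUnit
    rw [hz2, hcja] at hu
    have hC2 : (C 2 : MvPolynomial (Fin 3) ℂ) = 2 := map_ofNat C 2
    by_cases h1 : 1 + z = 0
    · apply fin1 s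
      have hz1 : z = -1 := by linear_combination h1
      rw [hz1] at hu
      have h2 : a = C Complex.I * cx s := by
        have h3 : (C 2 : MvPolynomial (Fin 3) ℂ) * a = C 2 * (C Complex.I * cx s) := by
          have h4 : C (-1 : ℂ) = (-1 : MvPolynomial (Fin 3) ℂ) := by simp
          rw [h4] at hu
          rw [hC2]
          linear_combination hrs - hu
        exact (hCu 2 two_ne_zero).mul_left_cancel h3
      rw [h2]
      exact (associated_unit_mul_left _ _ (hCu _ Complex.I_ne_zero))
    · apply fin1 r
      have h2 : a * C (1 + z) = C 2 * cx r := by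
        rw [C_add, C_1, hC2]
        linear_combination hu + hrs
      have h5 : Associated a (a * C (1 + z)) := (associated_mul_unit_left _ _ (hCu _ h1)).symm
      rw [h2] at h5
      exact h5.trans (associated_unit_mul_left _ _ (hCu _ two_ne_zero))
  · exfalso
    obtain ⟨b, hb⟩ := hagc
    have hab : a ∣ b := by
      rw [hb] at hag
      rcases ha.prime.dvd_or_dvd hag with h | h
      · exact (hass ((ha.dvd_irreducible_iff_associated hconj).1 h)).elim
      · exact h
    obtain ⟨d, hd⟩ := hab
    have hnorm : cj a * a = cx (r ^ 2 + s ^ 2) := by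
      rw [hcja, hrs]
      simp only [cx, map_add, map_pow]
      linear_combination (-(MvPolynomial.map (algebraMap ℝ ℂ) s) ^ 2) * hII
    have hdv : cx (r ^ 2 + s ^ 2) ∣ cx g := by
      rw [← hnorm, hb, hd]
      exact ⟨d, by ring⟩
    obtain ⟨t, ht⟩ := cx_dvd hdv
    rcases real_factor hg6 hpsd hfin S hSsub hdim ht with ⟨c, hc, h⟩ | ⟨c, hc, h⟩
    · rw [h] at hnorm
      have := hcx c hc
      rw [← hnorm] at this
      exact ha.not_isUnit (isUnit_of_mul_isUnit_right this)
    · rw [h] at ht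
      by_cases hc0 : 0 ≤ c
      · apply not_sos hg6 hfin S hSsub hdim
        refine ⟨2, ![C (Real.sqrt c) * r, C (Real.sqrt c) * s], ?_⟩
        have : (C c : MvPolynomial (Fin 3) ℝ) = C (Real.sqrt c) ^ 2 := by
          rw [← C_pow, Real.sq_sqrt hc0]
        rw [ht, this, Fin.sum_univ_two]
        simp only [Matrix.cons_val_zero, Matrix.cons_val_one]
        ring
      · apply g0
        apply MvPolynomial.funext
        intro x
        have h1 := hpsd x
        have h2 : eval x g = (eval x r ^ 2 + eval x s ^ 2) * c := by rw [ht]; simp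
        rw [map_zero]
        push Not at hc0
        nlinarith [sq_nonneg (eval x r), sq_nonneg (eval x s)]

end S7

theorem statement7 (g : MvPolynomial (Fin 3) ℝ) (hg6 : g.IsHomogeneous 6) (hpsd : Psd g)
    (hfin : (VR g).Finite) (S : Set P2) (hSsub : S ⊆ VR g) (hS9 : S.encard = 9)
    (hdim : Module.finrank ℝ (Isub 3 S) = 1) :
    ¬ Sos g ∧ Irreducible (MvPolynomial.map (algebraMap ℝ ℂ) g) := by
  exact ⟨S7.not_sos hg6 hfin S hSsub hdim, S7.irred hg6 hpsd hfin S hSsub hdim⟩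

end
end
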